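/- arXiv:1901.07224 — 2 statements merged into one kernel-verified Lean document; each statement's English description precedes it below -/
import Mathlib

section
/- Uniqueness on the grim-reaper quadrilateral: let −π/2 < s < r < π/2 and a < b, and let Ω = Ω_{s,r,a,b}. Suppose u₁ and u₂ are 1-translator solutions on Ω such that (i) both extend continuously to Ω together with the relative interiors of the vertical segments C₁ and C₂, with u₁ = u₂ there, and (ii) uᵢ(p) → +∞ as p ∈ Ω tends to any point of the relative interiors of the grim-reaper arcs A₁ and A₂, for i = 1, 2. Then u₁ = u₂ on Ω. -/
open Real Set Filter Topology

/-- The partial derivative in the first (x) direction. -/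
noncomputable def pdx (u : ℝ × ℝ → ℝ) (p : ℝ × ℝ) : ℝ := fderiv ℝ u p (1, 0)

/-- The partial derivative in the second (t) direction. -/
noncomputable def pdt (u : ℝ × ℝ → ℝ) (p : ℝ × ℝ) : ℝ := fderiv ℝ u p (0, 1)

/-- `u` is a c-translator solution on `Ω`: it is C² on `Ω` and satisfies
`(1+u_t²)u_xx - 2u_x u_t u_xt + (1+u_x²)u_tt + c u_t (1+u_x²+u_t²) = 0` there. -/
def IsTranslator (c : ℝ) (Ω : Set (ℝ × ℝ)) (u : ℝ × ℝ → ℝ) : Prop :=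
  ContDiffOn ℝ 2 u Ω ∧ ∀ p ∈ Ω,
    (1 + pdt u p ^ 2) * pdx (pdx u) p - 2 * pdx u p * pdt u p * pdx (pdt u) p
      + (1 + pdx u p ^ 2) * pdt (pdt u) p
      + c * pdt u p * (1 + pdx u p ^ 2 + pdt u p ^ 2) = 0

/-- The grim-reaper quadrilateral Ω_{s,r,a,b}. -/
def GRQuad (s r a b : ℝ) : Set (ℝ × ℝ) :=
  {p : ℝ × ℝ | s < p.1 ∧ p.1 < r ∧
    a - Real.log (Real.cos p.1) < p.2 ∧ p.2 < b - Real.log (Real.cos p.1)}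

/-- The relative interior of the grim-reaper boundary arc at height `h`. -/
def grimArcInt (s r h : ℝ) : Set (ℝ × ℝ) :=
  (fun x => (x, h - Real.log (Real.cos x))) '' Set.Ioo s r

/-- The relative interior of the vertical boundary segment above `x₀`. -/
def vertSegInt (x₀ a b : ℝ) : Set (ℝ × ℝ) :=
  {x₀} ×ˢ Set.Ioo (a - Real.log (Real.cos x₀)) (b - Real.log (Real.cos x₀))

open MeasureTheory

section PartialDerivatives

variable {u v : ℝ × ℝ → ℝ} {p : ℝ × ℝ}

lemma pdx_mul (hu : DifferentiableAt ℝ u p) (hv : DifferentiableAt ℝ v p) :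
    pdx (fun q => u q * v q) p = u p * pdx v p + v p * pdx u p := by
  simp [pdx, fderiv_fun_mul hu hv]

lemma pdt_mul (hu : DifferentiableAt ℝ u p) (hv : DifferentiableAt ℝ v p) :
    pdt (fun q => u q * v q) p = u p * pdt v p + v p * pdt u p := by
  simp [pdt, fderiv_fun_mul hu hv]

lemma pdx_sub (hu : DifferentiableAt ℝ u p) (hv : DifferentiableAt ℝ v p) :
    pdx (fun q => u q - v q) p = pdx u p - pdx v p := by
  simp [pdx, fderiv_fun_sub hu hv]

lemma pdt_sub (hu : DifferentiableAt ℝ u p) (hv : DifferentiableAt ℝ v p) :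
    pdt (fun q => u q - v q) p = pdt u p - pdt v p := by
  simp [pdt, fderiv_fun_sub hu hv]

lemma pdx_comp {f : ℝ → ℝ} (hf : DifferentiableAt ℝ f (u p)) (hu : DifferentiableAt ℝ u p) :
    pdx (fun q => f (u q)) p = deriv f (u p) * pdx u p := by
  have := (hf.hasDerivAt.comp_hasFDerivAt p hu.hasFDerivAt).fderiv
  simp only [pdx]
  erw [this]
  simp

lemma pdt_comp {f : ℝ → ℝ} (hf : DifferentiableAt ℝ f (u p)) (hu : DifferentiableAt ℝ u p) :
    pdt (fun q => f (u q)) p = deriv f (u p) * pdt u p := by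
  have := (hf.hasDerivAt.comp_hasFDerivAt p hu.hasFDerivAt).fderiv
  simp only [pdt]
  erw [this]
  simp

lemma pdx_fst : pdx (fun q => q.1) p = 1 := by
  simp [pdx, fderiv_fst]

lemma pdt_fst : pdt (fun q => q.1) p = 0 := by
  simp [pdt, fderiv_fst]

variable {Ω : Set (ℝ × ℝ)}

lemma ContDiffOn.pdx_of_isOpen {n : ℕ} (hu : ContDiffOn ℝ (n + 1) u Ω) (hΩ : IsOpen Ω) :
    ContDiffOn ℝ n (pdx u) Ω :=
  (hu.fderiv_of_isOpen hΩ le_rfl).clm_apply contDiffOn_const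

lemma ContDiffOn.pdt_of_isOpen {n : ℕ} (hu : ContDiffOn ℝ (n + 1) u Ω) (hΩ : IsOpen Ω) :
    ContDiffOn ℝ n (pdt u) Ω :=
  (hu.fderiv_of_isOpen hΩ le_rfl).clm_apply contDiffOn_const

lemma ContDiffOn.continuousOn_pdx (hu : ContDiffOn ℝ 1 u Ω) (hΩ : IsOpen Ω) :
    ContinuousOn (pdx u) Ω :=
  (ContDiffOn.pdx_of_isOpen (n := 0) (by simpa using hu) hΩ).continuousOn

lemma ContDiffOn.continuousOn_pdt (hu : ContDiffOn ℝ 1 u Ω) (hΩ : IsOpen Ω) :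
    ContinuousOn (pdt u) Ω :=
  (ContDiffOn.pdt_of_isOpen (n := 0) (by simpa using hu) hΩ).continuousOn

lemma pdx_pdt_comm (hu : ContDiffOn ℝ 2 u Ω) (hΩ : IsOpen Ω) (hp : p ∈ Ω) :
    pdx (pdt u) p = pdt (pdx u) p := by
  have hc : ContDiffAt ℝ 2 u p := hu.contDiffAt (hΩ.mem_nhds hp)
  have hs : IsSymmSndFDerivAt ℝ u p := hc.isSymmSndFDerivAt (by simp)
  have hd : DifferentiableAt ℝ (fderiv ℝ u) p :=
    (hc.fderiv_right (m := 1) (by norm_num)).differentiableAt (by simp)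
  have key : ∀ w w' : ℝ × ℝ, fderiv ℝ (fun q => fderiv ℝ u q w) p w'
      = fderiv ℝ (fderiv ℝ u) p w' w := by
    intro w w'
    rw [fderiv_clm_apply hd (differentiableAt_const w)]
    simp
  unfold pdx pdt
  rw [key, key]
  exact hs _ _

end PartialDerivatives

/-- A function of class `C¹` on an open set and vanishing off a compact subset of it is a valid
test function for a divergence-free `C¹` vector field. -/
lemma integral_testFunction_eq_zero {Ω K : Set (ℝ × ℝ)} {F G φ : ℝ × ℝ → ℝ}
    (hΩ : IsOpen Ω) (hK : IsCompact K) (hKΩ : K ⊆ Ω)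
    (hF : ContDiffOn ℝ 1 F Ω) (hG : ContDiffOn ℝ 1 G Ω)
    (hdiv : ∀ p ∈ Ω, pdx F p + pdt G p = 0)
    (hφ : ContDiffOn ℝ 1 φ Ω) (hφK : ∀ p ∈ Ω, p ∉ K → φ p = 0) :
    IntegrableOn (fun p => F p * pdx φ p + G p * pdt φ p) Ω ∧
      ∫ p in Ω, (F p * pdx φ p + G p * pdt φ p) = 0 := by
  classical
  set ψ : ℝ × ℝ → ℝ := Ω.indicator φ with hψ
  have hψφ : ∀ p ∈ Ω, ψ =ᶠ[𝓝 p] φ := fun p hp =>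
    (Set.eqOn_indicator (s := Ω) (f := φ)).eventuallyEq_of_mem (hΩ.mem_nhds hp)
  have hψK : ∀ p, p ∉ K → ψ p = 0 := by
    intro p hp
    by_cases hpΩ : p ∈ Ω
    · simp [hψ, hpΩ, hφK p hpΩ hp]
    · simp [hψ, hpΩ]
  have hts : tsupport ψ ⊆ K :=
    closure_minimal (fun p hp => by_contra fun h => hp (hψK p h)) hK.isClosed
  have hψd : ∀ p, ContDiffAt ℝ 1 ψ p := by
    intro p
    by_cases hp : p ∈ Ω
    · exact (hφ.contDiffAt (hΩ.mem_nhds hp)).congr_of_eventuallyEq (hψφ p hp)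
    · have : ψ =ᶠ[𝓝 p] fun _ => 0 := by
        have := notMem_tsupport_iff_eventuallyEq.1 (fun h => hp (hKΩ (hts h)))
        exact this
      exact contDiffAt_const.congr_of_eventuallyEq this
  have hψc : ContDiff ℝ 1 ψ := contDiff_iff_contDiffAt.2 hψd
  have hψf : Continuous (fderiv ℝ ψ) := hψc.continuous_fderiv (by simp)
  have hψ0 : ∀ p, p ∉ K → fderiv ℝ ψ p = 0 := fun p hp => by
    have : ψ =ᶠ[𝓝 p] fun _ => 0 := by
      filter_upwards [hK.isClosed.isOpen_compl.mem_nhds hp] with q hq using hψK q hq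
    rw [this.fderiv_eq]; simp
  have parts : ∀ (H : ℝ × ℝ → ℝ) (w : ℝ × ℝ), ContDiffOn ℝ 1 H Ω →
      Integrable (fun p => fderiv ℝ H p w * ψ p) ∧ Integrable (fun p => H p * fderiv ℝ ψ p w) ∧
      ∫ p, H p * fderiv ℝ ψ p w = - ∫ p, fderiv ℝ H p w * ψ p := by
    intro H w hH
    have hHf : ContinuousOn (fun p => fderiv ℝ H p w) Ω :=
      (hH.continuousOn_fderiv_of_isOpen hΩ le_rfl).clm_apply continuousOn_const
    have i1 : Integrable (fun p => fderiv ℝ H p w * ψ p) := by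
      refine IntegrableOn.integrable_of_forall_notMem_eq_zero (s := K) ?_
        fun p hp => by simp [hψK p hp]
      exact ((hHf.mono hKΩ).mul hψc.continuous.continuousOn).integrableOn_compact hK
    have i2 : Integrable (fun p => H p * fderiv ℝ ψ p w) := by
      refine IntegrableOn.integrable_of_forall_notMem_eq_zero (s := K) ?_
        fun p hp => by simp [hψ0 p hp]
      exact ((hH.continuousOn.mono hKΩ).mul
        (hψf.clm_apply continuous_const).continuousOn).integrableOn_compact hK
    have i3 : Integrable (fun p => ψ p * H p) := by
      refine IntegrableOn.integrable_of_forall_notMem_eq_zero (s := K) ?_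
        fun p hp => by simp [hψK p hp]
      exact (hψc.continuous.continuousOn.mul
        (hH.continuousOn.mono hKΩ)).integrableOn_compact hK
    refine ⟨i1, i2, ?_⟩
    have := integral_smul_fderiv_eq_neg_fderiv_smul_of_integrable (μ := volume) (𝕜 := ℝ)
      (f := ψ) (g := H) (v := w) (by simpa [mul_comm] using i2) (by simpa [mul_comm] using i1)
      (by simpa using i3) (fun p _ => (hψd p).differentiableAt (by simp))
      (fun p hp => (hH.contDiffAt (hΩ.mem_nhds (hKΩ (hts hp)))).differentiableAt (by simp))
    simp only [smul_eq_mul] at this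
    simp only [mul_comm (H _), mul_comm (fderiv ℝ H _ _)]
    linarith
  obtain ⟨iF1, iF2, eF⟩ := parts F (1, 0) hF
  obtain ⟨iG1, iG2, eG⟩ := parts G (0, 1) hG
  have hcongr : ∀ p ∈ Ω, F p * pdx φ p + G p * pdt φ p
      = F p * fderiv ℝ ψ p (1, 0) + G p * fderiv ℝ ψ p (0, 1) := by
    intro p hp
    simp only [pdx, pdt, (hψφ p hp).fderiv_eq]
  constructor
  · exact (integrableOn_congr_fun hcongr hΩ.measurableSet).2 (iF2.add iG2).integrableOn
  · rw [setIntegral_congr_fun hΩ.measurableSet hcongr,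
      setIntegral_eq_integral_of_forall_compl_eq_zero, integral_add iF2 iG2, eF, eG,
      ← neg_add, ← integral_add iF1 iG1, neg_eq_zero]
    · refine integral_eq_zero_of_ae (Eventually.of_forall fun p => ?_)
      by_cases hp : p ∈ Ω
      · have := hdiv p hp
        simp only [pdx, pdt] at this
        simp only [← add_mul, this, zero_mul, Pi.zero_apply]
      · simp [hψK p fun h => hp (hKΩ h)]
    · intro p hp
      simp [hψ0 p fun h => hp (hKΩ h)]

/-- The area element `√(1 + |∇u|²)` of the graph of `u`. -/
noncomputable def areaElement (u : ℝ × ℝ → ℝ) (p : ℝ × ℝ) : ℝ :=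
  √(1 + pdx u p ^ 2 + pdt u p ^ 2)

/-- The first component of the weighted flux field `eᵗ ∇u / √(1 + |∇u|²)`. -/
noncomputable def fluxX (u : ℝ × ℝ → ℝ) (p : ℝ × ℝ) : ℝ :=
  Real.exp p.2 * (pdx u p / areaElement u p)

/-- The second component of the weighted flux field `eᵗ ∇u / √(1 + |∇u|²)`. -/
noncomputable def fluxT (u : ℝ × ℝ → ℝ) (p : ℝ × ℝ) : ℝ :=
  Real.exp p.2 * (pdt u p / areaElement u p)

section Flux

variable {u v : ℝ × ℝ → ℝ} {p : ℝ × ℝ} {Ω : Set (ℝ × ℝ)}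

lemma areaElement_pos : 0 < areaElement u p := Real.sqrt_pos.2 (by positivity)

lemma areaElement_sq : areaElement u p ^ 2 = 1 + pdx u p ^ 2 + pdt u p ^ 2 :=
  Real.sq_sqrt (by positivity)

lemma fluxX_sq_add_fluxT_sq_le : fluxX u p ^ 2 + fluxT u p ^ 2 ≤ Real.exp p.2 ^ 2 := by
  have h := areaElement_pos (u := u) (p := p)
  have h2 := areaElement_sq (u := u) (p := p)
  have : fluxX u p ^ 2 + fluxT u p ^ 2
      = Real.exp p.2 ^ 2 * ((pdx u p ^ 2 + pdt u p ^ 2) / areaElement u p ^ 2) := by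
    unfold fluxX fluxT; field_simp
  rw [this]
  refine mul_le_of_le_one_right (by positivity) ?_
  rw [div_le_one (by positivity), h2]
  linarith

lemma abs_fluxX_le : |fluxX u p| ≤ Real.exp p.2 :=
  abs_le_of_sq_le_sq (by nlinarith [fluxX_sq_add_fluxT_sq_le (u := u) (p := p)])
    (Real.exp_pos _).le

/-- The flux of `u` through any direction of weighted length `eᵗ` is at most `eᵗ`. -/
lemma flux_inner_le {P Q : ℝ} (h : P ^ 2 + Q ^ 2 = 1) :
    fluxX u p * P + fluxT u p * Q ≤ Real.exp p.2 := by
  refine abs_le_of_sq_le_sq' ?_ (Real.exp_pos _).le |>.2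
  have := fluxX_sq_add_fluxT_sq_le (u := u) (p := p)
  nlinarith [sq_nonneg (fluxX u p * Q - fluxT u p * P)]

/-- A calibration estimate: against a field of length `eᵗ`, the flux field loses at most `eᵗ`. -/
lemma neg_exp_le_flux_sub_inner {P Q : ℝ} (h : P ^ 2 + Q ^ 2 = Real.exp p.2 ^ 2) :
    -Real.exp p.2 ≤ (fluxX u p - P) * pdx u p + (fluxT u p - Q) * pdt u p := by
  have hW := areaElement_pos (u := u) (p := p)
  have hW2 := areaElement_sq (u := u) (p := p)
  have hE := Real.exp_pos p.2
  have h1 : fluxX u p * pdx u p + fluxT u p * pdt u p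
      = Real.exp p.2 * (areaElement u p - 1 / areaElement u p) := by
    unfold fluxX fluxT
    field_simp
    linarith
  have h2 : P * pdx u p + Q * pdt u p ≤ Real.exp p.2 * areaElement u p := by
    refine abs_le_of_sq_le_sq' ?_ (by positivity) |>.2
    rw [mul_pow, hW2, ← h]
    nlinarith [sq_nonneg (P * pdt u p - Q * pdx u p), sq_nonneg P, sq_nonneg Q]
  have h3 : 1 / areaElement u p ≤ 1 := by
    rw [div_le_one hW]
    nlinarith [sq_nonneg (pdx u p), sq_nonneg (pdt u p)]
  nlinarith

lemma flux_monotone_aux {a b c d W V : ℝ} (hW : 0 < W) (hV : 0 < V)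
    (hW2 : W ^ 2 = 1 + a ^ 2 + b ^ 2) (hV2 : V ^ 2 = 1 + c ^ 2 + d ^ 2) :
    1 + a * c + b * d ≤ W * V ∧ (W * V = 1 + a * c + b * d → a = c ∧ b = d) ∧
    (a / W - c / V) * (a - c) + (b / W - d / V) * (b - d)
      = (W + V) * (W * V - (1 + a * c + b * d)) / (W * V) := by
  have key : (W * V) ^ 2 - (1 + a * c + b * d) ^ 2
      = (a - c) ^ 2 + (b - d) ^ 2 + (a * d - b * c) ^ 2 := by
    rw [mul_pow, hW2, hV2]; ring
  refine ⟨abs_le_of_sq_le_sq' ?_ (by positivity) |>.2, fun h => ?_, ?_⟩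
  · nlinarith [sq_nonneg (a - c), sq_nonneg (b - d), sq_nonneg (a * d - b * c)]
  · rw [h, sub_self] at key
    constructor
    · nlinarith [sq_nonneg (a - c), sq_nonneg (b - d), sq_nonneg (a * d - b * c)]
    · nlinarith [sq_nonneg (a - c), sq_nonneg (b - d), sq_nonneg (a * d - b * c)]
  · field_simp
    linear_combination (-V) * hW2 - W * hV2

/-- The flux field depends monotonically on the gradient. -/
lemma flux_monotone : 0 ≤ (fluxX u p - fluxX v p) * (pdx u p - pdx v p)
    + (fluxT u p - fluxT v p) * (pdt u p - pdt v p) := by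
  obtain ⟨h1, -, h3⟩ := flux_monotone_aux (areaElement_pos (u := u) (p := p))
    (areaElement_pos (u := v) (p := p)) areaElement_sq areaElement_sq
  have : (fluxX u p - fluxX v p) * (pdx u p - pdx v p)
    + (fluxT u p - fluxT v p) * (pdt u p - pdt v p) = Real.exp p.2 *
      ((areaElement u p + areaElement v p) * (areaElement u p * areaElement v p
        - (1 + pdx u p * pdx v p + pdt u p * pdt v p)) / (areaElement u p * areaElement v p)) := by
    rw [← h3]; unfold fluxX fluxT; ring
  rw [this]
  have := areaElement_pos (u := u) (p := p)
  have := areaElement_pos (u := v) (p := p)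
  have := sub_nonneg.2 h1
  positivity

lemma gradient_eq_of_flux_eq_zero (h : (fluxX u p - fluxX v p) * (pdx u p - pdx v p)
    + (fluxT u p - fluxT v p) * (pdt u p - pdt v p) = 0) :
    pdx u p = pdx v p ∧ pdt u p = pdt v p := by
  obtain ⟨-, h2, h3⟩ := flux_monotone_aux (areaElement_pos (u := u) (p := p))
    (areaElement_pos (u := v) (p := p)) areaElement_sq areaElement_sq
  have hU := areaElement_pos (u := u) (p := p)
  have hV := areaElement_pos (u := v) (p := p)
  have : (fluxX u p - fluxX v p) * (pdx u p - pdx v p)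
    + (fluxT u p - fluxT v p) * (pdt u p - pdt v p) = Real.exp p.2 *
      ((areaElement u p + areaElement v p) * (areaElement u p * areaElement v p
        - (1 + pdx u p * pdx v p + pdt u p * pdt v p)) / (areaElement u p * areaElement v p)) := by
    rw [← h3]; unfold fluxX fluxT; ring
  rw [this] at h
  have hne := (Real.exp_pos p.2).ne'
  have : areaElement u p + areaElement v p ≠ 0 := by positivity
  apply h2
  simpa [hne, this, hU.ne', hV.ne', sub_eq_zero] using h

variable {c : ℝ}

lemma contDiffOn_areaElement (hu : ContDiffOn ℝ 2 u Ω) (hΩ : IsOpen Ω) :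
    ContDiffOn ℝ 1 (areaElement u) Ω := by
  have hx : ContDiffOn ℝ 1 (pdx u) Ω := ContDiffOn.pdx_of_isOpen (n := 1) hu hΩ
  have ht : ContDiffOn ℝ 1 (pdt u) Ω := ContDiffOn.pdt_of_isOpen (n := 1) hu hΩ
  exact ((contDiffOn_const.add (hx.pow 2)).add (ht.pow 2)).sqrt fun q _ => by positivity

lemma contDiffOn_fluxX (hu : ContDiffOn ℝ 2 u Ω) (hΩ : IsOpen Ω) :
    ContDiffOn ℝ 1 (fluxX u) Ω := by
  have hx : ContDiffOn ℝ 1 (pdx u) Ω := ContDiffOn.pdx_of_isOpen (n := 1) hu hΩ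
  exact contDiffOn_snd.exp.mul (hx.div (contDiffOn_areaElement hu hΩ) fun q _ =>
    areaElement_pos.ne')

lemma contDiffOn_fluxT (hu : ContDiffOn ℝ 2 u Ω) (hΩ : IsOpen Ω) :
    ContDiffOn ℝ 1 (fluxT u) Ω := by
  have ht : ContDiffOn ℝ 1 (pdt u) Ω := ContDiffOn.pdt_of_isOpen (n := 1) hu hΩ
  exact contDiffOn_snd.exp.mul (ht.div (contDiffOn_areaElement hu hΩ) fun q _ =>
    areaElement_pos.ne')

/-- The translator equation says that the weighted flux field is divergence free. -/
lemma IsTranslator.div_flux_eq_zero (hu : IsTranslator 1 Ω u) (hΩ : IsOpen Ω) (hp : p ∈ Ω) :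
    pdx (fluxX u) p + pdt (fluxT u) p = 0 := by
  have hc : ContDiffOn ℝ 2 u Ω := hu.1
  have hn := hΩ.mem_nhds hp
  have dx : DifferentiableAt ℝ (pdx u) p :=
    ((ContDiffOn.pdx_of_isOpen (n := 1) hc hΩ).contDiffAt hn).differentiableAt (by simp)
  have dt : DifferentiableAt ℝ (pdt u) p :=
    ((ContDiffOn.pdt_of_isOpen (n := 1) hc hΩ).contDiffAt hn).differentiableAt (by simp)
  have hW := areaElement_pos (u := u) (p := p)
  have hW2 := areaElement_sq (u := u) (p := p)
  have hR : HasFDerivAt (fun q => 1 + pdx u q ^ 2 + pdt u q ^ 2)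
      ((2 * pdx u p) • fderiv ℝ (pdx u) p + (2 * pdt u p) • fderiv ℝ (pdt u) p) p := by
    have := ((dx.hasFDerivAt.pow 2).const_add 1).add (dt.hasFDerivAt.pow 2)
    refine this.congr_fderiv ?_
    ext <;> simp
  have hA : HasFDerivAt (areaElement u) ((1 / (2 * areaElement u p)) •
      ((2 * pdx u p) • fderiv ℝ (pdx u) p + (2 * pdt u p) • fderiv ℝ (pdt u) p)) p :=
    hR.sqrt (by positivity)
  have hE : HasFDerivAt (fun q : ℝ × ℝ => Real.exp q.2)
      (Real.exp p.2 • ContinuousLinearMap.snd ℝ ℝ ℝ) p := hasFDerivAt_snd.exp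
  have hI := (hasDerivAt_inv hW.ne').comp_hasFDerivAt p hA
  have hX := (hE.mul (dx.hasFDerivAt.mul hI)).fderiv
  have hT := (hE.mul (dt.hasFDerivAt.mul hI)).fderiv
  have eX : pdx (fluxX u) p = _ := congrArg (fun L : ℝ × ℝ →L[ℝ] ℝ => L (1, 0)) hX
  have eT : pdt (fluxT u) p = _ := congrArg (fun L : ℝ × ℝ →L[ℝ] ℝ => L (0, 1)) hT
  have hcomm : fderiv ℝ (pdt u) p (1, 0) = fderiv ℝ (pdx u) p (0, 1) := pdx_pdt_comm hc hΩ hp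
  have heq := hu.2 p hp
  rw [eX, eT]
  rw [show pdx (pdt u) p = fderiv ℝ (pdx u) p (0, 1) from hcomm,
    show pdx (pdx u) p = fderiv ℝ (pdx u) p (1, 0) from rfl,
    show pdt (pdt u) p = fderiv ℝ (pdt u) p (0, 1) from rfl] at heq
  simp only [Function.comp, Pi.mul_apply, _root_.add_apply, _root_.smul_apply,
    smul_eq_mul, ContinuousLinearMap.coe_snd', hcomm, one_mul] at heq ⊢
  generalize fderiv ℝ (pdx u) p (1, 0) = uxx at *
  generalize fderiv ℝ (pdx u) p (0, 1) = uxt at *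
  generalize fderiv ℝ (pdt u) p (0, 1) = utt at *
  generalize areaElement u p = W at *
  generalize pdx u p = ux at *
  generalize pdt u p = ut at *
  rw [← hW2] at heq
  field_simp
  linear_combination Real.exp p.2 * (heq + (uxx + utt) * hW2)

end Flux

section SmoothTransition

lemma differentiable_smoothTransition : Differentiable ℝ Real.smoothTransition :=
  (Real.smoothTransition.contDiff (n := 1)).differentiable (by simp)

lemma continuous_deriv_smoothTransition : Continuous (deriv Real.smoothTransition) :=
  (Real.smoothTransition.contDiff (n := 1)).continuous_deriv (by simp)

lemma deriv_smoothTransition_nonneg (x : ℝ) : 0 ≤ deriv Real.smoothTransition x :=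
  Real.smoothTransition.monotone.deriv_nonneg

lemma deriv_smoothTransition_of_nonpos {x : ℝ} (hx : x ≤ 0) :
    deriv Real.smoothTransition x = 0 := by
  refine IsLocalMin.deriv_eq_zero (Eventually.of_forall fun y => ?_)
  rw [Real.smoothTransition.zero_of_nonpos hx]
  exact Real.smoothTransition.nonneg y

lemma deriv_smoothTransition_of_one_le {x : ℝ} (hx : 1 ≤ x) :
    deriv Real.smoothTransition x = 0 := by
  refine IsLocalMax.deriv_eq_zero (Eventually.of_forall fun y => ?_)
  rw [Real.smoothTransition.one_of_one_le hx]
  exact Real.smoothTransition.le_one y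

lemma exists_deriv_smoothTransition_le : ∃ C, 0 < C ∧ ∀ x, deriv Real.smoothTransition x ≤ C := by
  obtain ⟨C, hC⟩ := (isCompact_Icc (a := (0 : ℝ)) (b := 1)).exists_bound_of_continuousOn
    continuous_deriv_smoothTransition.continuousOn
  refine ⟨max C 1, by positivity, fun x => ?_⟩
  by_cases h0 : x ≤ 0
  · rw [deriv_smoothTransition_of_nonpos h0]; positivity
  by_cases h1 : 1 ≤ x
  · rw [deriv_smoothTransition_of_one_le h1]; positivity
  · exact (le_abs_self _).trans ((hC x ⟨by linarith, by linarith⟩).trans (le_max_left _ _))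

end SmoothTransition

lemma ContinuousOn.integrableOn_of_isOpen_of_bounded {Ω : Set (ℝ × ℝ)} {f : ℝ × ℝ → ℝ} {M : ℝ}
    (hf : ContinuousOn f Ω) (hΩ : IsOpen Ω) (hvol : volume Ω ≠ ⊤) (hM : ∀ p ∈ Ω, |f p| ≤ M) :
    IntegrableOn f Ω := by
  have : IsFiniteMeasure (volume.restrict Ω) := ⟨by simpa using hvol.lt_top⟩
  exact Integrable.of_bound (hf.aestronglyMeasurable hΩ.measurableSet) M
    ((ae_restrict_iff' hΩ.measurableSet).2 (Eventually.of_forall hM))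

/-- Let `u` be a solution that tends to `+∞` along the part of `∂Ω` that meets the support of
the weight `w ≥ 0`. Then no divergence-free field of weighted length `eᵗ` has, tested against `w`,
a larger flux through that part of the boundary than the flux field of `u`. -/
lemma integral_flux_sub_nonneg {Ω : Set (ℝ × ℝ)} {u P Q w : ℝ × ℝ → ℝ} {M : ℝ}
    (hΩ : IsOpen Ω) (hvol : volume Ω ≠ ⊤) (hu : IsTranslator 1 Ω u)
    (hP : ContDiffOn ℝ 1 P Ω) (hQ : ContDiffOn ℝ 1 Q Ω)
    (hdiv : ∀ p ∈ Ω, pdx P p + pdt Q p = 0)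
    (hPQ : ∀ p ∈ Ω, P p ^ 2 + Q p ^ 2 = Real.exp p.2 ^ 2)
    (hw : ContDiffOn ℝ 1 w Ω) (hw0 : ∀ p ∈ Ω, 0 ≤ w p) (hwM : ∀ p ∈ Ω, w p ≤ M)
    (hxM : ∀ p ∈ Ω, |pdx w p| ≤ M) (htM : ∀ p ∈ Ω, |pdt w p| ≤ M)
    (heM : ∀ p ∈ Ω, Real.exp p.2 ≤ M)
    (hK : ∀ n : ℕ, ∃ K, IsCompact K ∧ K ⊆ Ω ∧ ∀ p ∈ Ω, p ∉ K → w p = 0 ∨ n ≤ u p) :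
    IntegrableOn (fun p => (fluxX u p - P p) * pdx w p + (fluxT u p - Q p) * pdt w p) Ω ∧
      0 ≤ ∫ p in Ω, ((fluxX u p - P p) * pdx w p + (fluxT u p - Q p) * pdt w p) := by
  obtain ⟨C, hC0, hC⟩ := exists_deriv_smoothTransition_le
  have hu2 : ContDiffOn ℝ 2 u Ω := hu.1
  have hu1 : ContDiffOn ℝ 1 u Ω := hu2.of_le (by norm_num)
  have hX := contDiffOn_fluxX hu2 hΩ
  have hT := contDiffOn_fluxT hu2 hΩ
  have hd : ∀ {f : ℝ × ℝ → ℝ}, ContDiffOn ℝ 1 f Ω → ∀ p ∈ Ω, DifferentiableAt ℝ f p :=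
    fun hf p hp => (hf.contDiffAt (hΩ.mem_nhds hp)).differentiableAt (by simp)
  set I : ℝ × ℝ → ℝ := fun p =>
    (fluxX u p - P p) * pdx w p + (fluxT u p - Q p) * pdt w p with hI
  have hIc : ContinuousOn I Ω :=
    ((hX.sub hP).continuousOn.mul (hw.continuousOn_pdx hΩ)).add
      ((hT.sub hQ).continuousOn.mul (hw.continuousOn_pdt hΩ))
  have hIM : ∀ p ∈ Ω, |I p| ≤ 4 * M * M := by
    intro p hp
    have hE := Real.exp_pos p.2
    have hM := heM p hp
    have h0 := fluxX_sq_add_fluxT_sq_le (u := u) (p := p)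
    have h1 : |fluxX u p| ≤ Real.exp p.2 := abs_fluxX_le
    have h2 : |fluxT u p| ≤ Real.exp p.2 :=
      abs_le_of_sq_le_sq (by nlinarith [sq_nonneg (fluxX u p)]) hE.le
    have h3 : |P p| ≤ Real.exp p.2 :=
      abs_le_of_sq_le_sq (by nlinarith [sq_nonneg (Q p), hPQ p hp]) hE.le
    have h4 : |Q p| ≤ Real.exp p.2 :=
      abs_le_of_sq_le_sq (by nlinarith [sq_nonneg (P p), hPQ p hp]) hE.le
    calc |I p| ≤ |fluxX u p - P p| * |pdx w p| + |fluxT u p - Q p| * |pdt w p| := by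
          rw [← abs_mul, ← abs_mul]; exact abs_add_le _ _
      _ ≤ (2 * M) * M + (2 * M) * M := by
          have hM0 : 0 ≤ M := hE.le.trans hM
          gcongr
          · exact (abs_sub _ _).trans (by linarith)
          · exact hxM p hp
          · exact (abs_sub _ _).trans (by linarith)
          · exact htM p hp
      _ = 4 * M * M := by ring
  have hIi : IntegrableOn I Ω := hIc.integrableOn_of_isOpen_of_bounded hΩ hvol hIM
  set θ : ℕ → ℝ × ℝ → ℝ := fun n p => 1 - Real.smoothTransition (u p - n) with hθ
  have hθd : ∀ n, ContDiffOn ℝ 1 (θ n) Ω := fun n =>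
    contDiffOn_const.sub ((Real.smoothTransition.contDiff (n := 1)).comp_contDiffOn
      (hu1.sub contDiffOn_const))
  have hθ0 : ∀ n p, 0 ≤ θ n p := fun n p => sub_nonneg.2 (Real.smoothTransition.le_one _)
  have hθ1 : ∀ n p, θ n p ≤ 1 := fun n p => sub_le_self _ (Real.smoothTransition.nonneg _)
  have hsc : ∀ n : ℕ, ContinuousOn (fun p => deriv Real.smoothTransition (u p - n)) Ω := fun n =>
    continuous_deriv_smoothTransition.comp_continuousOn (hu1.continuousOn.sub continuousOn_const)
  have hB : ∀ n : ℕ, ∀ p ∈ Ω,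
      |-(w p * deriv Real.smoothTransition (u p - n) * Real.exp p.2)| ≤ M * C * M := by
    intro n p hp
    have h1 := hw0 p hp
    have h2 := deriv_smoothTransition_nonneg (u p - n)
    have h3 := hwM p hp
    have h4 : 0 ≤ M := h1.trans h3
    rw [abs_neg, abs_of_nonneg (by positivity)]
    gcongr
    · exact hC _
    · exact heM p hp
  have lower : ∀ n : ℕ, ∫ p in Ω, -(w p * deriv Real.smoothTransition (u p - n) * Real.exp p.2)
      ≤ ∫ p in Ω, I p * θ n p := by
    intro n
    obtain ⟨K, hKc, hKΩ, hKw⟩ := hK (n + 1)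
    obtain ⟨i1, e1⟩ := integral_testFunction_eq_zero (φ := fun p => w p * θ n p) hΩ hKc hKΩ
      (hX.sub hP) (hT.sub hQ) (fun p hp => by
        rw [pdx_sub (hd hX p hp) (hd hP p hp), pdt_sub (hd hT p hp) (hd hQ p hp)]
        linarith [hu.div_flux_eq_zero hΩ hp, hdiv p hp])
      (hw.mul (hθd n)) (fun p hp hpK => by
        rcases hKw p hp hpK with h | h
        · simp [h]
        · have : θ n p = 0 := by
            simp only [hθ]
            rw [Real.smoothTransition.one_of_one_le (by push_cast at h; linarith), sub_self]
          simp [this])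
    have hpt : ∀ p ∈ Ω, (fluxX u p - P p) * pdx (fun p => w p * θ n p) p
        + (fluxT u p - Q p) * pdt (fun p => w p * θ n p) p
        = I p * θ n p - w p * deriv Real.smoothTransition (u p - n) *
          ((fluxX u p - P p) * pdx u p + (fluxT u p - Q p) * pdt u p) := by
      intro p hp
      have hdu : DifferentiableAt ℝ (fun q => u q - (n : ℝ)) p :=
        (hd hu1 p hp).sub_const _
      have hdc : DifferentiableAt ℝ (fun q => Real.smoothTransition (u q - n)) p :=
        (differentiable_smoothTransition _).comp p hdu
      have e1 : pdx (θ n) p = - (deriv Real.smoothTransition (u p - n) * pdx u p) := by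
        rw [pdx_sub (differentiableAt_const _) hdc,
          pdx_comp (u := fun q => u q - (n : ℝ)) (differentiable_smoothTransition _) hdu]
        simp [pdx, fderiv_sub_const]
      have e2 : pdt (θ n) p = - (deriv Real.smoothTransition (u p - n) * pdt u p) := by
        rw [pdt_sub (differentiableAt_const _) hdc,
          pdt_comp (u := fun q => u q - (n : ℝ)) (differentiable_smoothTransition _) hdu]
        simp [pdt, fderiv_sub_const]
      rw [pdx_mul (hd hw p hp) (hd (hθd n) p hp), pdt_mul (hd hw p hp) (hd (hθd n) p hp), e1, e2]
      simp only [hI]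
      ring
    have iIθ : IntegrableOn (fun p => I p * θ n p) Ω := by
      refine (hIc.mul (hθd n).continuousOn).integrableOn_of_isOpen_of_bounded hΩ hvol
        (M := 4 * M * M) fun p hp => ?_
      rw [abs_mul, abs_of_nonneg (hθ0 n p)]
      exact (mul_le_of_le_one_right (abs_nonneg _) (hθ1 n p)).trans (hIM p hp)
    rw [setIntegral_congr_fun hΩ.measurableSet hpt] at e1
    have i2 := (integrableOn_congr_fun hpt hΩ.measurableSet).1 i1
    have i3 : IntegrableOn (fun p => w p * deriv Real.smoothTransition (u p - n) *
          ((fluxX u p - P p) * pdx u p + (fluxT u p - Q p) * pdt u p)) Ω := by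
      have := iIθ.sub i2
      refine this.congr (Eventually.of_forall fun p => ?_)
      simp
    rw [integral_sub iIθ i3, sub_eq_zero] at e1
    rw [e1]
    refine setIntegral_mono_on ?_ i3 hΩ.measurableSet fun p hp => ?_
    · refine (((hw.continuousOn.mul (hsc n)).mul
        (by fun_prop)).neg).integrableOn_of_isOpen_of_bounded hΩ hvol (M := M * C * M)
        fun p hp => ?_
      exact hB n p hp
    · have := neg_exp_le_flux_sub_inner (u := u) (hPQ p hp)
      have h1 := mul_nonneg (hw0 p hp) (deriv_smoothTransition_nonneg (u p - n))
      nlinarith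
  have lim1 : Tendsto (fun n : ℕ => ∫ p in Ω, I p * θ n p) atTop (𝓝 (∫ p in Ω, I p)) := by
    refine tendsto_integral_of_dominated_convergence (fun p => |I p|)
      (fun n => (hIc.mul (hθd n).continuousOn).aestronglyMeasurable hΩ.measurableSet)
      hIi.abs (fun n => Eventually.of_forall fun p => ?_) (Eventually.of_forall fun p => ?_)
    · rw [Real.norm_eq_abs, abs_mul, abs_of_nonneg (hθ0 n p)]
      exact mul_le_of_le_one_right (abs_nonneg _) (hθ1 n p)
    · refine tendsto_const_nhds.congr' ?_
      filter_upwards [eventually_ge_atTop ⌈u p⌉₊] with n hn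
      have : u p ≤ n := (Nat.le_ceil _).trans (by exact_mod_cast hn)
      simp [hθ, Real.smoothTransition.zero_of_nonpos (sub_nonpos.2 this)]
  have lim2 : Tendsto (fun n : ℕ => ∫ p in Ω,
      -(w p * deriv Real.smoothTransition (u p - n) * Real.exp p.2)) atTop (𝓝 0) := by
    rw [← integral_zero (ℝ × ℝ) ℝ (μ := volume.restrict Ω)]
    refine tendsto_integral_of_dominated_convergence (fun p => M * C * M)
      (fun n => (((hw.continuousOn.mul (hsc n)).mul
        (by fun_prop)).neg).aestronglyMeasurable hΩ.measurableSet)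
      (integrableOn_const hvol)
      (fun n => (ae_restrict_iff' hΩ.measurableSet).2 (Eventually.of_forall fun p hp => ?_))
      (Eventually.of_forall fun p => ?_)
    · exact hB n p hp
    · refine tendsto_const_nhds.congr' ?_
      filter_upwards [eventually_ge_atTop ⌈u p⌉₊] with n hn
      have : u p ≤ n := (Nat.le_ceil _).trans (by exact_mod_cast hn)
      simp [deriv_smoothTransition_of_nonpos (sub_nonpos.2 this)]
  exact ⟨hIi, le_of_tendsto_of_tendsto' lim2 lim1 lower⟩

section GrimReaper

/-- The coordinate that is constant along each translated grim reaper curve `t = h - log cos x`. -/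
noncomputable def grimHeight (p : ℝ × ℝ) : ℝ := p.2 + Real.log (Real.cos p.1)

/-- The vertical strip over which the grim reaper curves are graphs. -/
def grimStrip : Set (ℝ × ℝ) := {p | -(π / 2) < p.1 ∧ p.1 < π / 2}

/-- The closed grim reaper quadrilateral. -/
def GRBox (s r a b : ℝ) : Set (ℝ × ℝ) :=
  {p | p.1 ∈ Set.Icc s r ∧ grimHeight p ∈ Set.Icc a b}

variable {s r a b : ℝ} {p : ℝ × ℝ}

lemma mem_GRQuad : p ∈ GRQuad s r a b ↔ p.1 ∈ Set.Ioo s r ∧ grimHeight p ∈ Set.Ioo a b := by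
  simp only [GRQuad, grimHeight, Set.mem_ofPred_eq, Set.mem_Ioo]
  constructor <;> rintro h <;> refine ⟨?_, ?_⟩ <;> grind

lemma cos_pos_of_mem_grimStrip (hp : p ∈ grimStrip) : 0 < Real.cos p.1 :=
  Real.cos_pos_of_mem_Ioo hp

lemma isOpen_grimStrip : IsOpen grimStrip :=
  (isOpen_lt continuous_const continuous_fst).inter (isOpen_lt continuous_fst continuous_const)

lemma GRQuad_subset_GRBox : GRQuad s r a b ⊆ GRBox s r a b := fun _ hp =>
  ⟨Set.Ioo_subset_Icc_self (mem_GRQuad.1 hp).1, Set.Ioo_subset_Icc_self (mem_GRQuad.1 hp).2⟩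

lemma GRBox_subset_grimStrip (hs : -(π / 2) < s) (hr : r < π / 2) :
    GRBox s r a b ⊆ grimStrip := fun _ hp => ⟨hs.trans_le hp.1.1, hp.1.2.trans_lt hr⟩

lemma contDiffOn_grimHeight : ContDiffOn ℝ 1 grimHeight grimStrip :=
  contDiffOn_snd.add ((Real.contDiff_cos.comp_contDiffOn contDiffOn_fst).log fun _ hp =>
    (cos_pos_of_mem_grimStrip hp).ne')

lemma hasFDerivAt_grimHeight (hp : p ∈ grimStrip) : HasFDerivAt grimHeight
    (ContinuousLinearMap.snd ℝ ℝ ℝ + (Real.cos p.1)⁻¹ •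
      (-Real.sin p.1) • ContinuousLinearMap.fst ℝ ℝ ℝ) p :=
  hasFDerivAt_snd.add ((hasFDerivAt_fst (p := p)).cos.log (cos_pos_of_mem_grimStrip hp).ne')

lemma pdx_grimHeight (hp : p ∈ grimStrip) :
    pdx grimHeight p = -Real.sin p.1 / Real.cos p.1 := by
  rw [pdx, (hasFDerivAt_grimHeight hp).fderiv]
  simp
  ring

lemma pdt_grimHeight (hp : p ∈ grimStrip) : pdt grimHeight p = 1 := by
  rw [pdt, (hasFDerivAt_grimHeight hp).fderiv]
  simp

lemma isOpen_GRQuad (hs : -(π / 2) < s) (hr : r < π / 2) : IsOpen (GRQuad s r a b) := by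
  have h1 : IsOpen (grimStrip ∩ grimHeight ⁻¹' Set.Ioo a b) :=
    contDiffOn_grimHeight.continuousOn.isOpen_inter_preimage isOpen_grimStrip isOpen_Ioo
  have h2 : IsOpen ((fun p : ℝ × ℝ => p.1) ⁻¹' Set.Ioo s r) := isOpen_Ioo.preimage continuous_fst
  convert h1.inter h2 using 1
  ext p
  simp only [mem_GRQuad, grimStrip, Set.mem_inter_iff, Set.mem_preimage, Set.mem_ofPred_eq,
    Set.mem_Ioo]
  constructor <;> rintro h <;> refine ⟨?_, ?_⟩ <;> grind

lemma isCompact_GRBox (hs : -(π / 2) < s) (hr : r < π / 2) : IsCompact (GRBox s r a b) := by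
  have hc : ContinuousOn (fun q : ℝ × ℝ => (q.1, q.2 - Real.log (Real.cos q.1)))
      (Set.Icc s r ×ˢ Set.Icc a b) := by
    refine continuousOn_fst.prodMk (continuousOn_snd.sub
      ((Real.continuous_cos.comp_continuousOn continuousOn_fst).log fun q hq => ?_))
    exact (Real.cos_pos_of_mem_Ioo ⟨hs.trans_le hq.1.1, hq.1.2.trans_lt hr⟩).ne'
  convert (isCompact_Icc.prod isCompact_Icc).image_of_continuousOn hc using 1
  ext ⟨x, t⟩
  simp only [GRBox, grimHeight, Set.mem_ofPred_eq, Set.mem_image, Set.mem_prod, Prod.exists,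
    Prod.mk.injEq]
  constructor
  · rintro ⟨h1, h2⟩
    exact ⟨x, t + Real.log (Real.cos x), ⟨h1, h2⟩, rfl, by ring⟩
  · rintro ⟨x', y, ⟨h1, h2⟩, rfl, rfl⟩
    exact ⟨h1, by simpa using h2⟩

lemma volume_GRQuad :
    volume (GRQuad s r a b) = ENNReal.ofReal (b - a) * ENNReal.ofReal (r - s) := by
  have hm (y : ℝ) : AEMeasurable (fun x => y - Real.log (Real.cos x))
      (volume.restrict (Set.Ioo s r)) := by fun_prop
  have : GRQuad s r a b = regionBetween (fun x => a - Real.log (Real.cos x))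
      (fun x => b - Real.log (Real.cos x)) (Set.Ioo s r) := by
    ext p
    simp only [GRQuad, regionBetween, Set.mem_ofPred_eq, Set.mem_Ioo]
    tauto
  rw [this, Measure.volume_eq_prod, volume_regionBetween_eq_lintegral
    (hm a) (hm b) measurableSet_Ioo]
  simp

lemma volume_GRQuad_ne_top : volume (GRQuad s r a b) ≠ ⊤ := by
  rw [volume_GRQuad]
  exact ENNReal.mul_ne_top ENNReal.ofReal_ne_top ENNReal.ofReal_ne_top

lemma volume_real_GRQuad (hsr : s ≤ r) (hab : a ≤ b) :
    volume.real (GRQuad s r a b) = (b - a) * (r - s) := by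
  rw [Measure.real, volume_GRQuad, ENNReal.toReal_mul, ENNReal.toReal_ofReal (by linarith),
    ENNReal.toReal_ofReal (by linarith)]

/-- A cutoff in the coordinates adapted to the grim reaper foliation. -/
noncomputable def grimProd (g h : ℝ → ℝ) (p : ℝ × ℝ) : ℝ := g p.1 * h (grimHeight p)

variable {g h : ℝ → ℝ}

lemma contDiffOn_grimProd (hg : ContDiff ℝ 1 g) (hh : ContDiff ℝ 1 h) :
    ContDiffOn ℝ 1 (grimProd g h) grimStrip :=
  (hg.comp_contDiffOn contDiffOn_fst).mul (hh.comp_contDiffOn contDiffOn_grimHeight)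

lemma pdx_grimProd (hg : ContDiff ℝ 1 g) (hh : ContDiff ℝ 1 h) (hp : p ∈ grimStrip) :
    pdx (grimProd g h) p = deriv g p.1 * h (grimHeight p)
      + g p.1 * (deriv h (grimHeight p) * (-Real.sin p.1 / Real.cos p.1)) := by
  have d1 : DifferentiableAt ℝ (fun q : ℝ × ℝ => g q.1) p :=
    (hg.differentiable (by simp) _).comp p differentiableAt_fst
  have d0 : DifferentiableAt ℝ grimHeight p := (hasFDerivAt_grimHeight hp).differentiableAt
  have d2 : DifferentiableAt ℝ (fun q : ℝ × ℝ => h (grimHeight q)) p :=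
    (hh.differentiable (by simp) _).comp p d0
  unfold grimProd
  rw [pdx_mul d1 d2, pdx_comp (hh.differentiable (by simp) _) d0, pdx_grimHeight hp,
    pdx_comp (u := fun q : ℝ × ℝ => q.1) (hg.differentiable (by simp) _) differentiableAt_fst,
    pdx_fst]
  ring

lemma pdt_grimProd (hg : ContDiff ℝ 1 g) (hh : ContDiff ℝ 1 h) (hp : p ∈ grimStrip) :
    pdt (grimProd g h) p = g p.1 * deriv h (grimHeight p) := by
  have d1 : DifferentiableAt ℝ (fun q : ℝ × ℝ => g q.1) p :=
    (hg.differentiable (by simp) _).comp p differentiableAt_fst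
  have d0 : DifferentiableAt ℝ grimHeight p := (hasFDerivAt_grimHeight hp).differentiableAt
  have d2 : DifferentiableAt ℝ (fun q : ℝ × ℝ => h (grimHeight q)) p :=
    (hh.differentiable (by simp) _).comp p d0
  unfold grimProd
  rw [pdt_mul d1 d2, pdt_comp (hh.differentiable (by simp) _) d0, pdt_grimHeight hp,
    pdt_comp (u := fun q : ℝ × ℝ => q.1) (hg.differentiable (by simp) _) differentiableAt_fst,
    pdt_fst]
  ring

lemma exists_bound_grimProd (hs : -(π / 2) < s) (hr : r < π / 2)
    (hg : ContDiff ℝ 1 g) (hh : ContDiff ℝ 1 h) :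
    ∃ M, ∀ p ∈ GRQuad s r a b, |grimProd g h p| ≤ M ∧ |pdx (grimProd g h) p| ≤ M ∧
      |pdt (grimProd g h) p| ≤ M ∧ Real.exp p.2 ≤ M := by
  have hK := isCompact_GRBox (a := a) (b := b) hs hr
  have hU := GRBox_subset_grimStrip (a := a) (b := b) hs hr
  have hw := contDiffOn_grimProd hg hh
  obtain ⟨M1, h1⟩ := hK.exists_bound_of_continuousOn (hw.continuousOn.mono hU)
  obtain ⟨M2, h2⟩ := hK.exists_bound_of_continuousOn
    ((hw.continuousOn_pdx isOpen_grimStrip).mono hU)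
  obtain ⟨M3, h3⟩ := hK.exists_bound_of_continuousOn
    ((hw.continuousOn_pdt isOpen_grimStrip).mono hU)
  obtain ⟨M4, h4⟩ := hK.exists_bound_of_continuousOn (f := fun p : ℝ × ℝ => Real.exp p.2)
    (by fun_prop)
  refine ⟨max (max M1 M2) (max M3 M4), fun p hp => ?_⟩
  have hp' := GRQuad_subset_GRBox hp
  refine ⟨(h1 p hp').trans (by simp), (h2 p hp').trans (by simp), (h3 p hp').trans (by simp),
    (le_abs_self _).trans ((h4 p hp').trans (by simp))⟩

end GrimReaper

lemma setIntegral_le_mul_measureReal {Ω A : Set (ℝ × ℝ)} {f : ℝ × ℝ → ℝ} {C : ℝ}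
    (hΩ : MeasurableSet Ω) (hA : MeasurableSet A) (hAΩ : A ⊆ Ω) (hvol : volume Ω ≠ ⊤)
    (hf : IntegrableOn f Ω) (h1 : ∀ p ∈ A, f p ≤ C) (h0 : ∀ p ∈ Ω, p ∉ A → f p ≤ 0) :
    ∫ p in Ω, f p ≤ C * volume.real A := by
  have hi : IntegrableOn (A.indicator fun _ => C) Ω :=
    (integrableOn_const hvol).indicator hA
  calc ∫ p in Ω, f p ≤ ∫ p in Ω, A.indicator (fun _ => C) p := by
        refine setIntegral_mono_on hf hi hΩ fun p hp => ?_
        by_cases hpA : p ∈ A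
        · simpa [hpA] using h1 p hpA
        · simpa [hpA] using h0 p hp hpA
    _ = C * volume.real A := by
        rw [setIntegral_indicator hA, Set.inter_eq_right.2 hAΩ, setIntegral_const, smul_eq_mul,
          mul_comm]

section LayerDefect

/-- The cutoff profile `y ↦ S (σ (y - e) / δ + 2)`, with `S` the smooth transition: for `σ = ±1` it
is a step of width `δ` at distance between `δ` and `2 * δ` from the height `e`. -/
noncomputable def layerProfile (σ e δ y : ℝ) : ℝ := Real.smoothTransition (σ * (y - e) / δ + 2)

/-- The defect between the flux of `u` through the grim reaper curves near height `e` and the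
largest possible flux, weighted by `g` and by the derivative of the cutoff profile. -/
noncomputable def layerDefect (σ e δ : ℝ) (g : ℝ → ℝ) (u : ℝ × ℝ → ℝ) (p : ℝ × ℝ) : ℝ :=
  g p.1 * (deriv Real.smoothTransition (σ * (grimHeight p - e) / δ + 2) / δ / Real.cos p.1) *
    (Real.exp p.2 - σ * (fluxX u p * (-Real.sin p.1) + fluxT u p * Real.cos p.1))

variable {s r a b σ e δ ρ E G : ℝ} {g : ℝ → ℝ} {u : ℝ × ℝ → ℝ} {p : ℝ × ℝ}

lemma contDiff_layerProfile : ContDiff ℝ 1 (layerProfile σ e δ) :=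
  Real.smoothTransition.contDiff.comp (by fun_prop)

lemma deriv_layerProfile (y : ℝ) : deriv (layerProfile σ e δ) y =
    deriv Real.smoothTransition (σ * (y - e) / δ + 2) * (σ / δ) := by
  have h1 : HasDerivAt (fun y => σ * (y - e) / δ + 2) (σ * 1 / δ) y :=
    ((((hasDerivAt_id y).sub_const e).const_mul σ).div_const δ).add_const 2
  have h2 := (differentiable_smoothTransition (σ * (y - e) / δ + 2)).hasDerivAt
  have h3 := (h2.comp y h1).deriv
  rwa [mul_one] at h3

lemma layerDefect_nonneg (hσ : σ = 1 ∨ σ = -1) (hδ : 0 < δ) (hg : ∀ x, 0 ≤ g x)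
    (hp : p ∈ grimStrip) : 0 ≤ layerDefect σ e δ g u p := by
  have hc := cos_pos_of_mem_grimStrip hp
  have hS := deriv_smoothTransition_nonneg (σ * (grimHeight p - e) / δ + 2)
  have hσ2 : σ ^ 2 = 1 := by rcases hσ with rfl | rfl <;> norm_num
  have h := flux_inner_le (u := u) (p := p) (P := σ * -Real.sin p.1) (Q := σ * Real.cos p.1) (by
    rw [mul_pow, mul_pow, hσ2, neg_sq]; linarith [Real.sin_sq_add_cos_sq p.1])
  exact mul_nonneg (mul_nonneg (hg _) (by positivity)) (by linarith)

lemma layer_pairing_eq (hσ : σ = 1 ∨ σ = -1) (hg : ContDiff ℝ 1 g) (hp : p ∈ grimStrip) :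
    (fluxX u p - -σ * Real.sin p.1 * Real.exp p.2) * pdx (grimProd g (layerProfile σ e δ)) p
      + (fluxT u p - σ * Real.cos p.1 * Real.exp p.2) * pdt (grimProd g (layerProfile σ e δ)) p
    = (fluxX u p - -σ * Real.sin p.1 * Real.exp p.2) *
        (deriv g p.1 * layerProfile σ e δ (grimHeight p)) - layerDefect σ e δ g u p := by
  have hc := (cos_pos_of_mem_grimStrip hp).ne'
  rw [pdx_grimProd hg contDiff_layerProfile hp, pdt_grimProd hg contDiff_layerProfile hp,
    deriv_layerProfile, layerDefect]
  generalize deriv Real.smoothTransition (σ * (grimHeight p - e) / δ + 2) = D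
  have key : g p.1 * (D * (σ / δ)) = g p.1 * (D / δ / Real.cos p.1) * σ * Real.cos p.1 := by
    field_simp
  have key' : g p.1 * (D * (σ / δ) * (-Real.sin p.1 / Real.cos p.1))
      = g p.1 * (D / δ / Real.cos p.1) * σ * (-Real.sin p.1) := by
    field_simp
  rw [key, key']
  generalize g p.1 * (D / δ / Real.cos p.1) = R
  have hs := Real.sin_sq_add_cos_sq p.1
  have hs' : Real.sin p.1 ^ 2 = 1 - Real.cos p.1 ^ 2 := by linarith
  rcases hσ with rfl | rfl <;> ring_nf <;> rw [hs'] <;> ring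

/-- A translator which is infinite on a grim reaper arc has asymptotically maximal flux through the
nearby grim reaper curves. -/
lemma integral_layerDefect_le (hs : -(π / 2) < s) (hsr : s < r) (hr : r < π / 2)
    (hu : IsTranslator 1 (GRQuad s r a b) u) (hσ : σ = 1 ∧ e = b ∨ σ = -1 ∧ e = a)
    (hA : ∀ q ∈ grimArcInt s r e, Tendsto u (𝓝[GRQuad s r a b] q) atTop)
    (hg : ContDiff ℝ 1 g) (hg0 : ∀ x, 0 ≤ g x) (hρ : 0 < ρ)
    (hgρ : ∀ x, x ∉ Set.Icc (s + ρ) (r - ρ) → g x = 0) (hG : ∀ x, |deriv g x| ≤ G)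
    (hE : ∀ p ∈ GRQuad s r a b, Real.exp p.2 ≤ E) (hδ : 0 < δ) (hδab : 2 * δ < b - a) :
    IntegrableOn (layerDefect σ e δ g u) (GRQuad s r a b) ∧
      ∫ p in GRQuad s r a b, layerDefect σ e δ g u p ≤ 2 * E * G * (2 * δ * (r - s)) := by
  have hσ' : σ = 1 ∨ σ = -1 := hσ.imp And.left And.left
  have hσ2 : σ ^ 2 = 1 := by rcases hσ' with rfl | rfl <;> norm_num
  obtain ⟨lo, hi, hlohi, halo, hhib, he, hzero⟩ : ∃ lo hi, hi - lo = 2 * δ ∧ a ≤ lo ∧ hi ≤ b ∧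
      (∀ y ∈ Set.Icc lo hi, y ≠ e → y ∈ Set.Ioo a b) ∧
      ∀ y ∈ Set.Ioo a b, y ∉ Set.Ioo lo hi → layerProfile σ e δ y = 0 := by
    rcases hσ with ⟨rfl, rfl⟩ | ⟨rfl, rfl⟩
    · refine ⟨e - 2 * δ, e, by ring, by linarith, le_rfl, fun y hy hye =>
        ⟨by linarith [hy.1], lt_of_le_of_ne hy.2 hye⟩, fun y hy hy' =>
        Real.smoothTransition.zero_of_nonpos ?_⟩
      have : y ≤ e - 2 * δ := by by_contra! h; exact hy' ⟨h, hy.2⟩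
      rw [← sub_neg_eq_add, sub_nonpos, div_le_iff₀ hδ]
      linarith
    · refine ⟨e, e + 2 * δ, by ring, le_rfl, by linarith, fun y hy hye =>
        ⟨lt_of_le_of_ne hy.1 hye.symm, by linarith [hy.2]⟩, fun y hy hy' =>
        Real.smoothTransition.zero_of_nonpos ?_⟩
      have : e + 2 * δ ≤ y := by by_contra! h; exact hy' ⟨hy.1, h⟩
      rw [← sub_neg_eq_add, sub_nonpos, div_le_iff₀ hδ]
      linarith
  set Ω := GRQuad s r a b with hΩdef
  have hΩ : IsOpen Ω := isOpen_GRQuad hs hr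
  have hΩs : Ω ⊆ grimStrip := GRQuad_subset_GRBox.trans (GRBox_subset_grimStrip hs hr)
  have hvol : volume Ω ≠ ⊤ := volume_GRQuad_ne_top
  set w := grimProd g (layerProfile σ e δ) with hw
  have hP1 : ContDiff ℝ 1 fun p : ℝ × ℝ => -σ * Real.sin p.1 * Real.exp p.2 := by fun_prop
  have hQ1 : ContDiff ℝ 1 fun p : ℝ × ℝ => σ * Real.cos p.1 * Real.exp p.2 := by fun_prop
  obtain ⟨M, hM⟩ := exists_bound_grimProd (a := a) (b := b) hs hr hg
    (contDiff_layerProfile (σ := σ) (e := e) (δ := δ))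
  have hprof (y : ℝ) : 0 ≤ layerProfile σ e δ y ∧ layerProfile σ e δ y ≤ 1 :=
    ⟨Real.smoothTransition.nonneg _, Real.smoothTransition.le_one _⟩
  obtain ⟨hI, hI0⟩ := integral_flux_sub_nonneg (w := w) (M := M) hΩ hvol hu
    hP1.contDiffOn hQ1.contDiffOn (fun p _ => by
      have e1 : HasFDerivAt (fun p : ℝ × ℝ => -σ * Real.sin p.1 * Real.exp p.2) _ p :=
        ((hasFDerivAt_fst (p := p)).sin.const_mul (-σ)).mul (hasFDerivAt_snd (p := p)).exp
      have e2 : HasFDerivAt (fun p : ℝ × ℝ => σ * Real.cos p.1 * Real.exp p.2) _ p :=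
        ((hasFDerivAt_fst (p := p)).cos.const_mul σ).mul (hasFDerivAt_snd (p := p)).exp
      rw [pdx, pdt, e1.fderiv, e2.fderiv]
      simp
      ring)
    (fun p _ => by
      have : Real.sin p.1 ^ 2 = 1 - Real.cos p.1 ^ 2 := by
        linarith [Real.sin_sq_add_cos_sq p.1]
      rw [mul_pow, mul_pow, mul_pow, mul_pow, neg_sq, hσ2, this]; ring)
    ((contDiffOn_grimProd hg contDiff_layerProfile).mono hΩs)
    (fun p _ => mul_nonneg (hg0 _) (hprof _).1)
    (fun p hp => (le_abs_self _).trans (hM p hp).1) (fun p hp => (hM p hp).2.1)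
    (fun p hp => (hM p hp).2.2.1) (fun p hp => (hM p hp).2.2.2) (fun n => by
      refine ⟨GRBox (s + ρ) (r - ρ) lo hi \ interior {p | p ∈ Ω → (n : ℝ) ≤ u p},
        (isCompact_GRBox (by linarith) (by linarith)).diff isOpen_interior, fun p hp => ?_,
        fun p hp hpK => ?_⟩
      · have hx : p.1 ∈ Set.Ioo s r := ⟨by linarith [hp.1.1.1], by linarith [hp.1.1.2]⟩
        refine mem_GRQuad.2 ⟨hx, he _ hp.1.2 fun hpe => hp.2 ?_⟩
        have hq : p ∈ grimArcInt s r e :=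
          ⟨p.1, hx, Prod.ext rfl (by simp only [← hpe, grimHeight]; ring)⟩
        exact mem_interior_iff_mem_nhds.2
          (eventually_nhdsWithin_iff.1 ((hA p hq).eventually_ge_atTop (n : ℝ)))
      · by_cases hpO : p ∈ interior {p | p ∈ Ω → (n : ℝ) ≤ u p}
        · exact Or.inr (interior_subset hpO hp)
        · left
          by_cases hx : p.1 ∈ Set.Icc (s + ρ) (r - ρ)
          · refine mul_eq_zero_of_right _ (hzero _ (mem_GRQuad.1 hp).2 fun hy => hpK ?_)
            exact ⟨⟨hx, Set.Ioo_subset_Icc_self hy⟩, hpO⟩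
          · exact mul_eq_zero_of_left (hgρ _ hx) _)
  set f : ℝ × ℝ → ℝ := fun p => (fluxX u p - -σ * Real.sin p.1 * Real.exp p.2) *
        (deriv g p.1 * layerProfile σ e δ (grimHeight p)) with hf
  have hfE (p) (hp : p ∈ Ω) : |f p| ≤ 2 * E * G := by
    have h1 := abs_fluxX_le (u := u) (p := p)
    have h2 : |-σ * Real.sin p.1 * Real.exp p.2| ≤ Real.exp p.2 := by
      rw [abs_mul, abs_mul, abs_neg, Real.abs_exp]
      have : |σ| = 1 := by rcases hσ' with rfl | rfl <;> norm_num
      rw [this, one_mul]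
      exact mul_le_of_le_one_left (Real.exp_pos _).le (Real.abs_sin_le_one _)
    have h3 := abs_sub (fluxX u p) (-σ * Real.sin p.1 * Real.exp p.2)
    have h4 := hE p hp
    have hG0 : 0 ≤ G := (abs_nonneg _).trans (hG p.1)
    rw [hf]
    simp only
    rw [abs_mul, abs_mul]
    refine mul_le_mul (by linarith) ?_ (by positivity) (by linarith [Real.exp_pos p.2])
    rw [abs_of_nonneg (hprof _).1]
    exact (mul_le_of_le_one_right (abs_nonneg _) (hprof _).2).trans (hG _)
  have hfc : ContinuousOn f Ω := by
    refine ((contDiffOn_fluxX hu.1 hΩ).continuousOn.sub hP1.continuous.continuousOn).mul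
      (((hg.continuous_deriv le_rfl).comp continuous_fst).continuousOn.mul
      (contDiff_layerProfile.continuous.comp_continuousOn
        (contDiffOn_grimHeight.continuousOn.mono hΩs)))
  have hfi : IntegrableOn f Ω := hfc.integrableOn_of_isOpen_of_bounded hΩ hvol hfE
  have hpt : Set.EqOn (layerDefect σ e δ g u) (fun p => f p -
      ((fluxX u p - -σ * Real.sin p.1 * Real.exp p.2) * pdx w p +
        (fluxT u p - σ * Real.cos p.1 * Real.exp p.2) * pdt w p)) Ω := fun p hp => by
    simp only [hw, hf]
    rw [layer_pairing_eq hσ' hg (hΩs hp)]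
    ring
  refine ⟨(hfi.sub hI).congr_fun hpt.symm hΩ.measurableSet, ?_⟩
  rw [setIntegral_congr_fun hΩ.measurableSet hpt, integral_sub hfi hI]
  have hbd : ∫ p in Ω, f p ≤ 2 * E * G * volume.real (GRQuad s r lo hi) := by
    refine setIntegral_le_mul_measureReal hΩ.measurableSet
      (isOpen_GRQuad hs hr).measurableSet (fun p hp => ?_) hvol hfi (fun p hp => ?_)
      fun p hp hpA => ?_
    · have := mem_GRQuad.1 hp
      exact mem_GRQuad.2 ⟨this.1, halo.trans_lt this.2.1, this.2.2.trans_le hhib⟩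
    · have := mem_GRQuad.1 hp
      exact (le_abs_self _).trans
        (hfE p (mem_GRQuad.2 ⟨this.1, halo.trans_lt this.2.1, this.2.2.trans_le hhib⟩))
    · have := mem_GRQuad.1 hp
      have h0 := hzero _ this.2 fun h => hpA (mem_GRQuad.2 ⟨this.1, h⟩)
      simp [hf, h0]
  rw [volume_real_GRQuad hsr.le (by linarith), hlohi] at hbd
  linarith

end LayerDefect

section Cutoffs

/-- A cutoff vanishing within `ρ` of the endpoints of `[s, r]`, equal to one at distance `2 * ρ`. -/
noncomputable def sideCutoff (s r ρ x : ℝ) : ℝ :=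
  Real.smoothTransition ((x - s) / ρ - 1) * Real.smoothTransition ((r - x) / ρ - 1)

/-- A cutoff vanishing within `δ` of the endpoints of `[a, b]`, equal to one at distance
`2 * δ`. -/
noncomputable def heightCutoff (a b δ y : ℝ) : ℝ :=
  (1 - layerProfile 1 b δ y) * (1 - layerProfile (-1) a δ y)

variable {s r a b ρ δ x y : ℝ}

lemma contDiff_sideCutoff : ContDiff ℝ 1 (sideCutoff s r ρ) :=
  (Real.smoothTransition.contDiff.comp (by fun_prop)).mul
    (Real.smoothTransition.contDiff.comp (by fun_prop))

lemma sideCutoff_nonneg : 0 ≤ sideCutoff s r ρ x :=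
  mul_nonneg (Real.smoothTransition.nonneg _) (Real.smoothTransition.nonneg _)

lemma sideCutoff_eq_zero (hρ : 0 < ρ) (hx : x ∉ Set.Icc (s + ρ) (r - ρ)) :
    sideCutoff s r ρ x = 0 := by
  by_cases h : s + ρ ≤ x
  · refine mul_eq_zero_of_right _ (Real.smoothTransition.zero_of_nonpos ?_)
    have : r - ρ < x := by by_contra! h'; exact hx ⟨h, h'⟩
    rw [sub_nonpos, div_le_one hρ]
    linarith
  · refine mul_eq_zero_of_left (Real.smoothTransition.zero_of_nonpos ?_) _
    rw [sub_nonpos, div_le_one hρ]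
    linarith

lemma one_le_sideCutoff_args (hρ : 0 < ρ) (hx : x ∈ Set.Icc (s + 2 * ρ) (r - 2 * ρ)) :
    1 ≤ (x - s) / ρ - 1 ∧ 1 ≤ (r - x) / ρ - 1 := by
  constructor <;> rw [le_sub_iff_add_le, le_div_iff₀ hρ] <;> linarith [hx.1, hx.2]

lemma sideCutoff_eq_one (hρ : 0 < ρ) (hx : x ∈ Set.Icc (s + 2 * ρ) (r - 2 * ρ)) :
    sideCutoff s r ρ x = 1 := by
  obtain ⟨h1, h2⟩ := one_le_sideCutoff_args hρ hx
  rw [sideCutoff, Real.smoothTransition.one_of_one_le h1, Real.smoothTransition.one_of_one_le h2,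
    one_mul]

lemma deriv_sideCutoff : deriv (sideCutoff s r ρ) x =
    deriv Real.smoothTransition ((x - s) / ρ - 1) / ρ *
      Real.smoothTransition ((r - x) / ρ - 1) - Real.smoothTransition ((x - s) / ρ - 1) *
      (deriv Real.smoothTransition ((r - x) / ρ - 1) / ρ) := by
  have h1 : HasDerivAt (fun x => (x - s) / ρ - 1) (1 / ρ) x :=
    (((hasDerivAt_id x).sub_const s).div_const ρ).sub_const 1
  have h2 : HasDerivAt (fun x => (r - x) / ρ - 1) (-1 / ρ) x :=
    (((hasDerivAt_id x).const_sub r).div_const ρ).sub_const 1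
  have h3 := (differentiable_smoothTransition ((x - s) / ρ - 1)).hasDerivAt.comp x h1
  have h4 := (differentiable_smoothTransition ((r - x) / ρ - 1)).hasDerivAt.comp x h2
  refine (h3.mul h4).deriv.trans ?_
  simp only [Function.comp_apply]
  ring

lemma deriv_sideCutoff_eq_zero (hρ : 0 < ρ) (hx : x ∈ Set.Icc (s + 2 * ρ) (r - 2 * ρ)) :
    deriv (sideCutoff s r ρ) x = 0 := by
  obtain ⟨h1, h2⟩ := one_le_sideCutoff_args hρ hx
  rw [deriv_sideCutoff, deriv_smoothTransition_of_one_le h1, deriv_smoothTransition_of_one_le h2]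
  simp

lemma abs_deriv_sideCutoff_le {C : ℝ} (hC : ∀ x, deriv Real.smoothTransition x ≤ C)
    (hρ : 0 < ρ) : |deriv (sideCutoff s r ρ) x| ≤ 2 * (C / ρ) := by
  have hle (y z : ℝ) : |deriv Real.smoothTransition y / ρ * Real.smoothTransition z| ≤ C / ρ := by
    have h0 : 0 ≤ deriv Real.smoothTransition y / ρ :=
      div_nonneg (deriv_smoothTransition_nonneg y) hρ.le
    rw [abs_of_nonneg (mul_nonneg h0 (Real.smoothTransition.nonneg z))]
    exact (mul_le_of_le_one_right h0 (Real.smoothTransition.le_one z)).trans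
      (div_le_div_of_nonneg_right (hC y) hρ.le)
  rw [deriv_sideCutoff, mul_comm (Real.smoothTransition _) (deriv _ _ / ρ)]
  refine (abs_sub _ _).trans ?_
  linarith [hle ((x - s) / ρ - 1) ((r - x) / ρ - 1), hle ((r - x) / ρ - 1) ((x - s) / ρ - 1)]

lemma layerProfile_mem_Icc {σ e : ℝ} : layerProfile σ e δ y ∈ Set.Icc 0 1 :=
  ⟨Real.smoothTransition.nonneg _, Real.smoothTransition.le_one _⟩

lemma contDiff_heightCutoff : ContDiff ℝ 1 (heightCutoff a b δ) :=
  (contDiff_const.sub contDiff_layerProfile).mul (contDiff_const.sub contDiff_layerProfile)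

lemma heightCutoff_mem_Icc : heightCutoff a b δ y ∈ Set.Icc 0 1 := by
  have h1 := layerProfile_mem_Icc (δ := δ) (y := y) (σ := 1) (e := b)
  have h2 := layerProfile_mem_Icc (δ := δ) (y := y) (σ := -1) (e := a)
  exact ⟨mul_nonneg (by linarith [h1.2]) (by linarith [h2.2]),
    mul_le_one₀ (by linarith [h1.1]) (by linarith [h2.2]) (by linarith [h2.1])⟩

lemma heightCutoff_eq_zero (hδ : 0 < δ) (hy : y ∉ Set.Icc (a + δ) (b - δ)) :
    heightCutoff a b δ y = 0 := by
  by_cases h : a + δ ≤ y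
  · have : b - δ < y := by by_contra! h'; exact hy ⟨h, h'⟩
    refine mul_eq_zero_of_left (sub_eq_zero.2 (Real.smoothTransition.one_of_one_le ?_).symm) _
    rw [← sub_le_iff_le_add, le_div_iff₀ hδ]
    linarith
  · refine mul_eq_zero_of_right _ (sub_eq_zero.2 (Real.smoothTransition.one_of_one_le ?_).symm)
    rw [← sub_le_iff_le_add, le_div_iff₀ hδ]
    linarith

lemma heightCutoff_eq_one (hδ : 0 < δ) (hy : y ∈ Set.Icc (a + 2 * δ) (b - 2 * δ)) :
    heightCutoff a b δ y = 1 := by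
  have h1 : layerProfile 1 b δ y = 0 := by
    refine Real.smoothTransition.zero_of_nonpos ?_
    rw [← sub_neg_eq_add, sub_nonpos, div_le_iff₀ hδ]
    linarith [hy.2]
  have h2 : layerProfile (-1) a δ y = 0 := by
    refine Real.smoothTransition.zero_of_nonpos ?_
    rw [← sub_neg_eq_add, sub_nonpos, div_le_iff₀ hδ]
    linarith [hy.1]
  rw [heightCutoff, h1, h2]
  norm_num

lemma deriv_heightCutoff : deriv (heightCutoff a b δ) y =
    -(deriv (layerProfile 1 b δ) y * (1 - layerProfile (-1) a δ y)) -
      (1 - layerProfile 1 b δ y) * deriv (layerProfile (-1) a δ) y := by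
  have h (σ e : ℝ) : HasDerivAt (fun y => 1 - layerProfile σ e δ y)
      (-deriv (layerProfile σ e δ) y) y :=
    ((contDiff_layerProfile.differentiable (by simp) y).hasDerivAt).const_sub 1
  refine ((h 1 b).mul (h (-1) a)).deriv.trans ?_
  ring

end Cutoffs

section Comparison

variable {s r a b : ℝ} {u₁ u₂ : ℝ × ℝ → ℝ}

lemma neg_mul_cutoff_pairing_le {g : ℝ → ℝ} {δ θ : ℝ} {p : ℝ × ℝ} (hp : p ∈ grimStrip)
    (hδ : 0 < δ) (hg : ContDiff ℝ 1 g) (hg0 : ∀ x, 0 ≤ g x) (hθ : θ ∈ Set.Icc 0 1) :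
    -θ * ((fluxX u₁ p - fluxX u₂ p) * pdx (grimProd g (heightCutoff a b δ)) p +
        (fluxT u₁ p - fluxT u₂ p) * pdt (grimProd g (heightCutoff a b δ)) p) ≤
      -θ * (fluxX u₁ p - fluxX u₂ p) *
          (deriv g p.1 * heightCutoff a b δ (grimHeight p)) +
        (layerDefect 1 b δ g u₂ p + layerDefect (-1) a δ g u₂ p) := by
  have hc := (cos_pos_of_mem_grimStrip hp).ne'
  have hle {σ e k : ℝ} (hσ : σ = 1 ∨ σ = -1) (hk : k ∈ Set.Icc 0 1) :
      θ * k * (layerDefect σ e δ g u₂ p - layerDefect σ e δ g u₁ p)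
        ≤ layerDefect σ e δ g u₂ p := by
    have h1 : 0 ≤ layerDefect σ e δ g u₁ p := layerDefect_nonneg hσ hδ hg0 hp
    have h2 : 0 ≤ layerDefect σ e δ g u₂ p := layerDefect_nonneg hσ hδ hg0 hp
    have h3 : 0 ≤ θ * k := mul_nonneg hθ.1 hk.1
    have h4 : θ * k ≤ 1 := mul_le_one₀ hθ.2 hk.1 hk.2
    nlinarith
  have k1 := layerProfile_mem_Icc (δ := δ) (y := grimHeight p) (σ := 1) (e := b)
  have k2 := layerProfile_mem_Icc (δ := δ) (y := grimHeight p) (σ := -1) (e := a)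
  have l1 := hle (e := b) (σ := 1) (k := 1 - layerProfile (-1) a δ (grimHeight p)) (Or.inl rfl)
    ⟨by linarith [k2.2], by linarith [k2.1]⟩
  have l2 := hle (e := a) (σ := -1) (k := 1 - layerProfile 1 b δ (grimHeight p)) (Or.inr rfl)
    ⟨by linarith [k1.2], by linarith [k1.1]⟩
  refine le_trans (le_of_eq ?_) (add_le_add_right (add_le_add l1 l2) _)
  rw [pdx_grimProd hg contDiff_heightCutoff hp, pdt_grimProd hg contDiff_heightCutoff hp,
    deriv_heightCutoff, deriv_layerProfile, deriv_layerProfile]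
  simp only [layerDefect]
  generalize layerProfile 1 b δ (grimHeight p) = L
  generalize layerProfile (-1) a δ (grimHeight p) = L'
  field_simp
  ring

lemma exists_lt_near_sides {w : ℝ × ℝ → ℝ} (hs : -(π / 2) < s) (hr : r < π / 2)
    (hw : ContinuousOn w (GRQuad s r a b ∪ vertSegInt s a b ∪ vertSegInt r a b))
    (hw0 : ∀ p ∈ vertSegInt s a b ∪ vertSegInt r a b, w p = 0) {ε κ : ℝ} (hε : 0 < ε)
    (hκ : 0 < κ) : ∃ ρ, 0 < ρ ∧ ∀ p ∈ GRQuad s r a b, grimHeight p ∈ Set.Icc (a + κ) (b - κ) →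
      (p.1 < s + ρ ∨ r - ρ < p.1) → w p < ε := by
  have hseg {x : ℝ} {p : ℝ × ℝ} (hx : p.1 = x) (hp : grimHeight p ∈ Set.Icc (a + κ) (b - κ)) :
      p ∈ vertSegInt x a b := by
    subst hx
    refine ⟨rfl, ?_⟩
    have h1 := hp.1
    have h2 := hp.2
    simp only [grimHeight] at h1 h2
    constructor <;> linarith
  have hD : GRBox s r (a + κ) (b - κ) ⊆ GRQuad s r a b ∪ vertSegInt s a b ∪ vertSegInt r a b := by
    intro p hp
    rcases eq_or_lt_of_le hp.1.1 with h | h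
    · exact Or.inl (Or.inr (hseg h.symm hp.2))
    rcases eq_or_lt_of_le hp.1.2 with h' | h'
    · exact Or.inr (hseg h' hp.2)
    · exact Or.inl (Or.inl (mem_GRQuad.2
        ⟨⟨h, h'⟩, by linarith [hp.2.1], by linarith [hp.2.2]⟩))
  have hDc : IsCompact (GRBox s r (a + κ) (b - κ)) := isCompact_GRBox hs hr
  have hK : IsCompact (GRBox s r (a + κ) (b - κ) ∩ w ⁻¹' Set.Ici ε) :=
    hDc.of_isClosed_subset ((hw.mono hD).preimage_isClosed_of_isClosed hDc.isClosed isClosed_Ici)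
      Set.inter_subset_left
  rcases (GRBox s r (a + κ) (b - κ) ∩ w ⁻¹' Set.Ici ε).eq_empty_or_nonempty with h | h
  · refine ⟨1, one_pos, fun p hp hpκ _ => ?_⟩
    by_contra! hε'
    exact Set.notMem_empty p (h ▸ ⟨⟨(GRQuad_subset_GRBox hp).1, hpκ⟩, hε'⟩)
  · obtain ⟨q, hq, hmin⟩ := hK.exists_isMinOn h
      (f := fun p : ℝ × ℝ => min (p.1 - s) (r - p.1)) (by fun_prop)
    have hne {x : ℝ} (hx : x = s ∨ x = r) : q.1 ≠ x := fun hqx => by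
      have := hw0 q (hx.imp (fun h => by subst h; exact hseg hqx hq.1.2) fun h => by subst h; exact hseg hqx hq.1.2)
      have h2 : ε ≤ w q := hq.2
      linarith
    refine ⟨min (q.1 - s) (r - q.1), lt_min ?_ ?_, fun p hp hpκ hside => ?_⟩
    · exact sub_pos.2 (lt_of_le_of_ne hq.1.1.1 (hne (Or.inl rfl)).symm)
    · exact sub_pos.2 (lt_of_le_of_ne hq.1.1.2 (hne (Or.inr rfl)))
    · by_contra! hε'
      have hle : min (q.1 - s) (r - q.1) ≤ min (p.1 - s) (r - p.1) :=
        hmin ⟨⟨(GRQuad_subset_GRBox hp).1, hpκ⟩, hε'⟩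
      have := le_min_iff.1 hle
      rcases hside with h | h <;> linarith [this.1, this.2]

/-- The flux gap of `u₁` and `u₂` paired with the derivative of `S (u₁ - u₂ - ε)`. -/
noncomputable def truncatedGap (ε : ℝ) (u₁ u₂ : ℝ × ℝ → ℝ) (p : ℝ × ℝ) : ℝ :=
  deriv Real.smoothTransition (u₁ p - u₂ p - ε) *
    ((fluxX u₁ p - fluxX u₂ p) * (pdx u₁ p - pdx u₂ p)
      + (fluxT u₁ p - fluxT u₂ p) * (pdt u₁ p - pdt u₂ p))

lemma truncatedGap_nonneg {ε : ℝ} {p : ℝ × ℝ} : 0 ≤ truncatedGap ε u₁ u₂ p :=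
  mul_nonneg (deriv_smoothTransition_nonneg _) flux_monotone

lemma volume_corners_le {ρ κ : ℝ} (hρ : 0 ≤ ρ) (hκ : 0 ≤ κ) :
    volume.real (GRQuad s (s + 2 * ρ) a (a + κ) ∪ GRQuad s (s + 2 * ρ) (b - κ) b ∪
      (GRQuad (r - 2 * ρ) r a (a + κ) ∪ GRQuad (r - 2 * ρ) r (b - κ) b)) ≤ 8 * ρ * κ := by
  have h1 := volume_real_GRQuad (s := s) (r := s + 2 * ρ) (a := a) (b := a + κ)
    (by linarith) (by linarith)
  have h2 := volume_real_GRQuad (s := s) (r := s + 2 * ρ) (a := b - κ) (b := b)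
    (by linarith) (by linarith)
  have h3 := volume_real_GRQuad (s := r - 2 * ρ) (r := r) (a := a) (b := a + κ)
    (by linarith) (by linarith)
  have h4 := volume_real_GRQuad (s := r - 2 * ρ) (r := r) (a := b - κ) (b := b)
    (by linarith) (by linarith)
  refine (measureReal_union_le _ _).trans ((add_le_add (measureReal_union_le _ _)
    (measureReal_union_le _ _)).trans (le_of_eq ?_))
  rw [h1, h2, h3, h4]
  ring

/-- The basic integral estimate: the truncated flux gap is controlled by the area of the corner
regions and by the flux defects in the layers near the grim reaper arcs. -/
lemma mul_volume_le_of_le_truncatedGap (hs : -(π / 2) < s) (hsr : s < r) (hr : r < π / 2)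
    (h₁ : IsTranslator 1 (GRQuad s r a b) u₁) (h₂ : IsTranslator 1 (GRQuad s r a b) u₂)
    (hA : ∀ q ∈ grimArcInt s r a ∪ grimArcInt s r b, Tendsto u₂ (𝓝[GRQuad s r a b] q) atTop)
    {ε κ ρ δ C E c : ℝ} (hC : ∀ x, deriv Real.smoothTransition x ≤ C)
    (hE : ∀ p ∈ GRQuad s r a b, Real.exp p.2 ≤ E) (hκ : 0 < κ) (hκab : κ ≤ b - a)
    (hρ : 0 < ρ) (hρsr : 2 * ρ ≤ r - s) (hδ : 0 < δ) (hδab : 2 * δ < b - a)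
    (hside : ∀ p ∈ GRQuad s r a b, grimHeight p ∈ Set.Icc (a + κ) (b - κ) →
      (p.1 < s + 2 * ρ ∨ r - 2 * ρ < p.1) → u₁ p - u₂ p < ε)
    {V : Set (ℝ × ℝ)} (hV : MeasurableSet V) (hVΩ : V ⊆ GRQuad s r a b)
    (hV' : V ⊆ GRBox (s + 2 * ρ) (r - 2 * ρ) (a + 2 * δ) (b - 2 * δ))
    (hVc : ∀ p ∈ V, c ≤ truncatedGap ε u₁ u₂ p) :
    c * volume.real V ≤ 4 * E * (C / ρ) * (8 * ρ * κ) +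
      2 * (2 * E * (2 * (C / ρ)) * (2 * δ * (r - s))) := by
  set Ω := GRQuad s r a b with hΩdef
  have hΩ : IsOpen Ω := isOpen_GRQuad hs hr
  have hΩs : Ω ⊆ grimStrip := GRQuad_subset_GRBox.trans (GRBox_subset_grimStrip hs hr)
  have hvol : volume Ω ≠ ⊤ := volume_GRQuad_ne_top
  set g := sideCutoff s r ρ
  set ζ := heightCutoff a b δ
  set χ := grimProd g ζ with hχdef
  have hg : ContDiff ℝ 1 g := contDiff_sideCutoff
  have hζ : ContDiff ℝ 1 ζ := contDiff_heightCutoff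
  have hg0 (x : ℝ) : 0 ≤ g x := sideCutoff_nonneg
  have hG (x : ℝ) : |deriv g x| ≤ 2 * (C / ρ) := abs_deriv_sideCutoff_le hC hρ
  have hχ : ContDiffOn ℝ 1 χ Ω := (contDiffOn_grimProd hg hζ).mono hΩs
  set T : ℝ × ℝ → ℝ := fun p => Real.smoothTransition (u₁ p - u₂ p - ε) with hT
  have hT01 (p : ℝ × ℝ) : T p ∈ Set.Icc 0 1 :=
    ⟨Real.smoothTransition.nonneg _, Real.smoothTransition.le_one _⟩
  have hu₁ : ContDiffOn ℝ 1 u₁ Ω := h₁.1.of_le (by norm_num)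
  have hu₂ : ContDiffOn ℝ 1 u₂ Ω := h₂.1.of_le (by norm_num)
  have hTc : ContDiffOn ℝ 1 T Ω := Real.smoothTransition.contDiff.comp_contDiffOn
    ((hu₁.sub hu₂).sub contDiffOn_const)
  have hF := (contDiffOn_fluxX h₁.1 hΩ).sub (contDiffOn_fluxX h₂.1 hΩ)
  have hH := (contDiffOn_fluxT h₁.1 hΩ).sub (contDiffOn_fluxT h₂.1 hΩ)
  have hdat {f : ℝ × ℝ → ℝ} (hf : ContDiffOn ℝ 1 f Ω) {p : ℝ × ℝ} (hp : p ∈ Ω) :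
      DifferentiableAt ℝ f p :=
    (hf.contDiffAt (hΩ.mem_nhds hp)).differentiableAt (by norm_num)
  obtain ⟨hΦi, hΦ0⟩ := integral_testFunction_eq_zero (φ := fun p => T p * χ p)
    (K := GRBox (s + ρ) (r - ρ) (a + δ) (b - δ)) hΩ
    (isCompact_GRBox (by linarith) (by linarith)) (fun p hp => mem_GRQuad.2
      ⟨⟨by linarith [hp.1.1], by linarith [hp.1.2]⟩, by linarith [hp.2.1], by linarith [hp.2.2]⟩)
    hF hH (fun p hp => by
      have e1 := h₁.div_flux_eq_zero hΩ hp
      have e2 := h₂.div_flux_eq_zero hΩ hp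
      rw [pdx_sub (hdat (contDiffOn_fluxX h₁.1 hΩ) hp) (hdat (contDiffOn_fluxX h₂.1 hΩ) hp),
        pdt_sub (hdat (contDiffOn_fluxT h₁.1 hΩ) hp) (hdat (contDiffOn_fluxT h₂.1 hΩ) hp)]
      linarith)
    (hTc.mul hχ) (fun p hp hpK => by
      refine mul_eq_zero_of_right _ ?_
      by_cases hx : p.1 ∈ Set.Icc (s + ρ) (r - ρ)
      · exact mul_eq_zero_of_right _ (heightCutoff_eq_zero hδ fun hy => hpK ⟨hx, hy⟩)
      · exact mul_eq_zero_of_left (sideCutoff_eq_zero hρ hx) _)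
  obtain ⟨hL, hL'⟩ := integral_layerDefect_le hs hsr hr h₂ (Or.inl ⟨rfl, rfl⟩)
    (fun q hq => hA q (Or.inr hq)) hg hg0 hρ (fun x hx => sideCutoff_eq_zero hρ hx) hG hE hδ hδab
  obtain ⟨hN, hN'⟩ := integral_layerDefect_le hs hsr hr h₂ (Or.inr ⟨rfl, rfl⟩)
    (fun q hq => hA q (Or.inl hq)) hg hg0 hρ (fun x hx => sideCutoff_eq_zero hρ hx) hG hE hδ hδab
  set f : ℝ × ℝ → ℝ := fun p => -T p * (fluxX u₁ p - fluxX u₂ p) *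
    (deriv g p.1 * ζ (grimHeight p)) with hf
  have hfE (p) (hp : p ∈ Ω) : |f p| ≤ 4 * E * (C / ρ) := by
    have h3 := abs_sub (fluxX u₁ p) (fluxX u₂ p)
    have h1 := abs_fluxX_le (u := u₁) (p := p)
    have h2 := abs_fluxX_le (u := u₂) (p := p)
    have h4 := hE p hp
    have hG0 : 0 ≤ 2 * (C / ρ) := (abs_nonneg _).trans (hG p.1)
    have hζ' : ζ (grimHeight p) ∈ Set.Icc 0 1 := heightCutoff_mem_Icc
    have e1 : |-T p * (fluxX u₁ p - fluxX u₂ p)| ≤ 2 * E := by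
      rw [abs_mul, abs_neg, abs_of_nonneg (hT01 p).1]
      refine (mul_le_of_le_one_left (abs_nonneg _) (hT01 p).2).trans (by linarith)
    have e2 : |deriv g p.1 * ζ (grimHeight p)| ≤ 2 * (C / ρ) := by
      rw [abs_mul, abs_of_nonneg hζ'.1]
      exact (mul_le_of_le_one_right (abs_nonneg _) hζ'.2).trans (hG _)
    calc |f p| ≤ 2 * E * (2 * (C / ρ)) := by
          rw [hf]
          simp only
          rw [abs_mul]
          exact mul_le_mul e1 e2 (abs_nonneg _) ((abs_nonneg _).trans e1)
      _ = 4 * E * (C / ρ) := by ring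
  have hfc : ContinuousOn f Ω :=
    (hTc.continuousOn.neg.mul hF.continuousOn).mul
      (((hg.continuous_deriv le_rfl).comp continuous_fst).continuousOn.mul
      (hζ.continuous.comp_continuousOn (contDiffOn_grimHeight.continuousOn.mono hΩs)))
  have hfi : IntegrableOn f Ω := hfc.integrableOn_of_isOpen_of_bounded hΩ hvol hfE
  set A := GRQuad s (s + 2 * ρ) a (a + κ) ∪ GRQuad s (s + 2 * ρ) (b - κ) b ∪
      (GRQuad (r - 2 * ρ) r a (a + κ) ∪ GRQuad (r - 2 * ρ) r (b - κ) b) with hAdef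
  have hAΩ : A ⊆ Ω := by
    have hmono {s' r' a' b' : ℝ} (h1 : s ≤ s') (h2 : r' ≤ r) (h3 : a ≤ a') (h4 : b' ≤ b) :
        GRQuad s' r' a' b' ⊆ Ω := fun p hp => mem_GRQuad.2
      ⟨Set.Ioo_subset_Ioo h1 h2 (mem_GRQuad.1 hp).1, Set.Ioo_subset_Ioo h3 h4 (mem_GRQuad.1 hp).2⟩
    refine Set.union_subset (Set.union_subset ?_ ?_) (Set.union_subset ?_ ?_) <;>
      apply hmono <;> linarith
  have hAm : MeasurableSet A := by
    refine IsOpen.measurableSet (IsOpen.union (IsOpen.union ?_ ?_) (IsOpen.union ?_ ?_)) <;>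
      apply isOpen_GRQuad <;> linarith
  have hfint : ∫ p in Ω, f p ≤ 4 * E * (C / ρ) * (8 * ρ * κ) := by
    have hC0 : 0 ≤ 4 * E * (C / ρ) := by
      obtain ⟨x, hx⟩ := exists_between hsr
      obtain ⟨y, hy⟩ := exists_between (show a < b by linarith)
      have : (x, y - Real.log (Real.cos x)) ∈ Ω :=
        mem_GRQuad.2 ⟨hx, by simpa [grimHeight] using hy⟩
      exact (abs_nonneg _).trans (hfE _ this)
    refine (setIntegral_le_mul_measureReal hΩ.measurableSet hAm hAΩ hvol hfi
      (fun p hp => (le_abs_self _).trans (hfE p (hAΩ hp))) fun p hp hpA => le_of_eq ?_).trans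
      (mul_le_mul_of_nonneg_left (volume_corners_le hρ.le hκ.le) hC0)
    by_cases hx : p.1 ∈ Set.Icc (s + 2 * ρ) (r - 2 * ρ)
    · simp [hf, g, deriv_sideCutoff_eq_zero hρ hx]
    · have hx' : p.1 < s + 2 * ρ ∨ r - 2 * ρ < p.1 := by
        by_contra! h
        exact hx h
      have hy : grimHeight p ∈ Set.Icc (a + κ) (b - κ) := by
        by_contra hy
        have hy' : grimHeight p < a + κ ∨ b - κ < grimHeight p := by
          by_contra! h
          exact hy h
        obtain ⟨p1, p2⟩ := mem_GRQuad.1 hp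
        refine hpA ?_
        rcases hx' with h | h <;> rcases hy' with h' | h'
        · exact Or.inl (Or.inl (mem_GRQuad.2 ⟨⟨p1.1, h⟩, p2.1, h'⟩))
        · exact Or.inl (Or.inr (mem_GRQuad.2 ⟨⟨p1.1, h⟩, h', p2.2⟩))
        · exact Or.inr (Or.inl (mem_GRQuad.2 ⟨⟨h, p1.2⟩, p2.1, h'⟩))
        · exact Or.inr (Or.inr (mem_GRQuad.2 ⟨⟨h, p1.2⟩, h', p2.2⟩))
      have : T p = 0 := Real.smoothTransition.zero_of_nonpos (by linarith [hside p hp hy hx'])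
      simp [hf, this]
  have hpt (p) (hp : p ∈ Ω) : V.indicator (fun _ => c) p ≤
      ((fluxX u₁ p - fluxX u₂ p) * pdx (fun p => T p * χ p) p
        + (fluxT u₁ p - fluxT u₂ p) * pdt (fun p => T p * χ p) p)
      + (f p + (layerDefect 1 b δ g u₂ p + layerDefect (-1) a δ g u₂ p)) := by
    have hpw := neg_mul_cutoff_pairing_le (u₁ := u₁) (u₂ := u₂) (a := a) (b := b) (hΩs hp) hδ hg
      hg0 (hT01 p)
    have hsub : DifferentiableAt ℝ (fun p => u₁ p - u₂ p - ε) p :=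
      ((hdat hu₁ hp).sub (hdat hu₂ hp)).sub_const ε
    have hsub' : DifferentiableAt ℝ (fun p => u₁ p - u₂ p) p := (hdat hu₁ hp).sub (hdat hu₂ hp)
    have e1 : pdx T p = deriv Real.smoothTransition (u₁ p - u₂ p - ε) * (pdx u₁ p - pdx u₂ p) := by
      rw [hT, pdx_comp (differentiable_smoothTransition _) hsub,
        ← pdx_sub (hdat hu₁ hp) (hdat hu₂ hp), pdx, pdx, fderiv_sub_const]
    have e2 : pdt T p = deriv Real.smoothTransition (u₁ p - u₂ p - ε) * (pdt u₁ p - pdt u₂ p) := by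
      rw [hT, pdt_comp (differentiable_smoothTransition _) hsub,
        ← pdt_sub (hdat hu₁ hp) (hdat hu₂ hp), pdt, pdt, fderiv_sub_const]
    have hle : V.indicator (fun _ => c) p ≤ truncatedGap ε u₁ u₂ p * χ p := by
      by_cases hpV : p ∈ V
      · have hχ1 : χ p = 1 := by
          have a1 : g p.1 = 1 := sideCutoff_eq_one hρ (hV' hpV).1
          have a2 : ζ (grimHeight p) = 1 := heightCutoff_eq_one hδ (hV' hpV).2
          rw [hχdef, grimProd, a1, a2, one_mul]
        rw [Set.indicator_of_mem hpV, hχ1, mul_one]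
        exact hVc p hpV
      · rw [Set.indicator_of_notMem hpV]
        exact mul_nonneg truncatedGap_nonneg (mul_nonneg (hg0 _) heightCutoff_mem_Icc.1)
    refine hle.trans ?_
    rw [pdx_mul (hdat hTc hp) (hdat hχ hp), pdt_mul (hdat hTc hp) (hdat hχ hp), e1, e2]
    have : truncatedGap ε u₁ u₂ p * χ p = deriv Real.smoothTransition (u₁ p - u₂ p - ε) *
        ((fluxX u₁ p - fluxX u₂ p) * (pdx u₁ p - pdx u₂ p)
      + (fluxT u₁ p - fluxT u₂ p) * (pdt u₁ p - pdt u₂ p)) * χ p := rfl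
    rw [this]
    simp only [hf]
    linarith
  have hVi : IntegrableOn (V.indicator fun _ => c) Ω := (integrableOn_const hvol).indicator hV
  have hmain := setIntegral_mono_on hVi (hΦi.add (hfi.add (hL.add hN))) hΩ.measurableSet hpt
  have hV1 : ∫ p in Ω, V.indicator (fun _ => c) p = c * volume.real V := by
    rw [setIntegral_indicator hV, Set.inter_eq_right.2 hVΩ, setIntegral_const, smul_eq_mul,
      mul_comm]
  have hV2 := integral_add hΦi (hfi.add (hL.add hN))
  have hV3 := integral_add hfi (hL.add hN)
  have hV4 := integral_add hL hN
  simp only [Pi.add_apply] at hmain hV2 hV3 hV4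
  rw [hV1, hV2, hV3, hV4, hΦ0] at hmain
  linarith

lemma truncatedGap_eq_zero (hs : -(π / 2) < s) (hr : r < π / 2)
    (h₁ : IsTranslator 1 (GRQuad s r a b) u₁) (h₂ : IsTranslator 1 (GRQuad s r a b) u₂)
    (hA : ∀ q ∈ grimArcInt s r a ∪ grimArcInt s r b, Tendsto u₂ (𝓝[GRQuad s r a b] q) atTop)
    {ε : ℝ} (hside : ∀ κ > 0, ∃ ρ, 0 < ρ ∧ ∀ p ∈ GRQuad s r a b,
      grimHeight p ∈ Set.Icc (a + κ) (b - κ) → (p.1 < s + ρ ∨ r - ρ < p.1) → u₁ p - u₂ p < ε)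
    {p : ℝ × ℝ} (hp : p ∈ GRQuad s r a b) : truncatedGap ε u₁ u₂ p = 0 := by
  refine le_antisymm ?_ truncatedGap_nonneg
  by_contra! hpos
  obtain ⟨hx, hy⟩ := mem_GRQuad.1 hp
  have hsr : s < r := hx.1.trans hx.2
  have hab : a < b := hy.1.trans hy.2
  have hΩ : IsOpen (GRQuad s r a b) := isOpen_GRQuad hs hr
  obtain ⟨C, hC0, hC⟩ := exists_deriv_smoothTransition_le
  obtain ⟨E, hE⟩ := (isCompact_GRBox (a := a) (b := b) hs hr).exists_bound_of_continuousOn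
    (f := fun p : ℝ × ℝ => Real.exp p.2) (by fun_prop)
  replace hE (q) (hq : q ∈ GRQuad s r a b) : Real.exp q.2 ≤ E :=
    (le_abs_self _).trans (hE q (GRQuad_subset_GRBox hq))
  have hE0 : 0 < E := (Real.exp_pos _).trans_le (hE p hp)
  have hu₁ : ContDiffOn ℝ 1 u₁ (GRQuad s r a b) := h₁.1.of_le (by norm_num)
  have hu₂ : ContDiffOn ℝ 1 u₂ (GRQuad s r a b) := h₂.1.of_le (by norm_num)
  have hJ : ContinuousOn (truncatedGap ε u₁ u₂) (GRQuad s r a b) :=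
    (continuous_deriv_smoothTransition.comp_continuousOn
      ((hu₁.continuousOn.sub hu₂.continuousOn).sub continuousOn_const)).mul
    ((((contDiffOn_fluxX h₁.1 hΩ).continuousOn.sub (contDiffOn_fluxX h₂.1 hΩ).continuousOn).mul
      ((hu₁.continuousOn_pdx hΩ).sub (hu₂.continuousOn_pdx hΩ))).add
    (((contDiffOn_fluxT h₁.1 hΩ).continuousOn.sub (contDiffOn_fluxT h₂.1 hΩ).continuousOn).mul
      ((hu₁.continuousOn_pdt hΩ).sub (hu₂.continuousOn_pdt hΩ))))
  set c := truncatedGap ε u₁ u₂ p / 2 with hc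
  set ρ₁ := min (p.1 - s) (r - p.1) / 4 with hρ₁
  set δ₁ := min (grimHeight p - a) (b - grimHeight p) / 4 with hδ₁
  have hρ₁0 : 0 < ρ₁ := div_pos (lt_min (sub_pos.2 hx.1) (sub_pos.2 hx.2)) (by norm_num)
  have hδ₁0 : 0 < δ₁ := div_pos (lt_min (sub_pos.2 hy.1) (sub_pos.2 hy.2)) (by norm_num)
  have hρs : 4 * ρ₁ ≤ p.1 - s := by linarith [min_le_left (p.1 - s) (r - p.1)]
  have hρr : 4 * ρ₁ ≤ r - p.1 := by linarith [min_le_right (p.1 - s) (r - p.1)]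
  have hδa : 4 * δ₁ ≤ grimHeight p - a := by
    linarith [min_le_left (grimHeight p - a) (b - grimHeight p)]
  have hδb : 4 * δ₁ ≤ b - grimHeight p := by
    linarith [min_le_right (grimHeight p - a) (b - grimHeight p)]
  set V := (GRQuad s r a b ∩ truncatedGap ε u₁ u₂ ⁻¹' Set.Ioi c) ∩
    GRQuad (s + 2 * ρ₁) (r - 2 * ρ₁) (a + 2 * δ₁) (b - 2 * δ₁) with hVdef
  have hV : IsOpen V := (hJ.isOpen_inter_preimage hΩ isOpen_Ioi).inter
    (isOpen_GRQuad (by linarith) (by linarith))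
  have hVΩ : V ⊆ GRQuad s r a b := fun q hq => hq.1.1
  have hpV : p ∈ V := ⟨⟨hp, show c < _ by linarith⟩, mem_GRQuad.2
    ⟨⟨by linarith, by linarith⟩, by linarith, by linarith⟩⟩
  have hm : 0 < volume.real V :=
    ENNReal.toReal_pos (hV.measure_pos volume ⟨p, hpV⟩).ne'
      (ne_top_of_le_ne_top volume_GRQuad_ne_top (measure_mono hVΩ))
  set η := c * volume.real V with hη
  have hη0 : 0 < η := mul_pos (by linarith) hm
  set κ := min (b - a) (η / (96 * E * C)) with hκ
  have hκ0 : 0 < κ := lt_min (by linarith) (by positivity)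
  obtain ⟨ρ₀, hρ₀, hρ₀s⟩ := hside κ hκ0
  set ρ := min ρ₁ (ρ₀ / 2) with hρ
  have hρ0 : 0 < ρ := lt_min hρ₁0 (by positivity)
  have hρle : ρ ≤ ρ₁ := min_le_left _ _
  have hρle' : 2 * ρ ≤ ρ₀ := by linarith [min_le_right ρ₁ (ρ₀ / 2)]
  have hsr0 : 0 < r - s := sub_pos.2 hsr
  set δ := min δ₁ (η * ρ / (48 * E * C * (r - s))) with hδ
  have hδ0 : 0 < δ := lt_min hδ₁0 (by positivity)
  have hδle : δ ≤ δ₁ := min_le_left _ _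
  have hmain := mul_volume_le_of_le_truncatedGap hs hsr hr h₁ h₂ hA hC hE hκ0 (min_le_left _ _)
    hρ0 (by linarith) hδ0 (by linarith)
    (fun q hq hqκ hqs => hρ₀s q hq hqκ (hqs.imp (fun h => by linarith) fun h => by linarith))
    hV.measurableSet hVΩ (fun q hq => by
      obtain ⟨q1, q2⟩ := mem_GRQuad.1 hq.2
      exact ⟨⟨by linarith [q1.1], by linarith [q1.2]⟩, by linarith [q2.1], by linarith [q2.2]⟩)
    (fun q hq => (show c < _ from hq.1.2).le)
  have b1 : κ * (96 * E * C) ≤ η := (le_div_iff₀ (by positivity)).1 (min_le_right _ _)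
  have b2 : δ * (48 * E * C * (r - s)) ≤ η * ρ :=
    (le_div_iff₀ (by positivity)).1 (min_le_right _ _)
  have e1 : 4 * E * (C / ρ) * (8 * ρ * κ) = κ * (96 * E * C) / 3 := by field_simp; ring
  have e2 : 2 * (2 * E * (2 * (C / ρ)) * (2 * δ * (r - s)))
      = δ * (48 * E * C * (r - s)) / ρ / 3 := by field_simp; ring
  have b3 : δ * (48 * E * C * (r - s)) / ρ ≤ η := (div_le_iff₀ hρ0).2 b2
  linarith

/-- Comparison principle: the translator with smaller lateral data lies below the one which is
infinite on the grim reaper arcs. -/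
lemma translator_le (hs : -(π / 2) < s) (hr : r < π / 2)
    (h₁ : IsTranslator 1 (GRQuad s r a b) u₁) (h₂ : IsTranslator 1 (GRQuad s r a b) u₂)
    {w : ℝ × ℝ → ℝ} (hwu : ∀ p ∈ GRQuad s r a b, w p = u₁ p - u₂ p)
    (hw : ContinuousOn w (GRQuad s r a b ∪ vertSegInt s a b ∪ vertSegInt r a b))
    (hw0 : ∀ p ∈ vertSegInt s a b ∪ vertSegInt r a b, w p = 0)
    (hA : ∀ q ∈ grimArcInt s r a ∪ grimArcInt s r b, Tendsto u₂ (𝓝[GRQuad s r a b] q) atTop)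
    {p : ℝ × ℝ} (hp : p ∈ GRQuad s r a b) : u₁ p ≤ u₂ p := by
  refine le_of_forall_pos_le_add fun ε hε => ?_
  have hside (κ : ℝ) (hκ : κ > 0) : ∃ ρ, 0 < ρ ∧ ∀ p ∈ GRQuad s r a b,
      grimHeight p ∈ Set.Icc (a + κ) (b - κ) → (p.1 < s + ρ ∨ r - ρ < p.1) →
        u₁ p - u₂ p < ε := by
    obtain ⟨ρ, hρ, h⟩ := exists_lt_near_sides hs hr hw hw0 hε hκ
    exact ⟨ρ, hρ, fun p hp h1 h2 => hwu p hp ▸ h p hp h1 h2⟩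
  have hΩ : IsOpen (GRQuad s r a b) := isOpen_GRQuad hs hr
  obtain ⟨hx, hy⟩ := mem_GRQuad.1 hp
  set γ : ℝ → ℝ × ℝ := fun x => (x, grimHeight p - Real.log (Real.cos x)) with hγ
  have hγτ (x : ℝ) : grimHeight (γ x) = grimHeight p := by simp [hγ, grimHeight]
  have hγΩ {x : ℝ} (hx : x ∈ Set.Ioo s r) : γ x ∈ GRQuad s r a b :=
    mem_GRQuad.2 ⟨hx, by rwa [hγτ]⟩
  have hγp : γ p.1 = p := by simp [hγ, grimHeight]
  have hderiv {x : ℝ} (hx : x ∈ Set.Ioo s r) : HasDerivAt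
      (fun x => Real.smoothTransition (u₁ (γ x) - u₂ (γ x) - ε)) 0 x := by
    have hdat {u : ℝ × ℝ → ℝ} (hu : IsTranslator 1 (GRQuad s r a b) u) :
        DifferentiableAt ℝ u (γ x) :=
      (hu.1.contDiffAt (hΩ.mem_nhds (hγΩ hx))).differentiableAt (by norm_num)
    have hcos : 0 < Real.cos x := Real.cos_pos_of_mem_Ioo ⟨hs.trans hx.1, hx.2.trans hr⟩
    have hγd : HasDerivAt γ (1, -(-Real.sin x / Real.cos x)) x :=
      (hasDerivAt_id x).prodMk (((Real.hasDerivAt_cos x).log hcos.ne').const_sub _)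
    have hu {u : ℝ × ℝ → ℝ} (hu : IsTranslator 1 (GRQuad s r a b) u) : HasDerivAt
        (fun x => u (γ x)) (pdx u (γ x) + -(-Real.sin x / Real.cos x) * pdt u (γ x)) x := by
      refine ((hdat hu).hasFDerivAt.comp_hasDerivAt x hγd).congr_deriv ?_
      rw [show ((1 : ℝ), -(-Real.sin x / Real.cos x)) =
        (1, 0) + (-(-Real.sin x / Real.cos x)) • ((0 : ℝ), (1 : ℝ)) by simp, map_add, map_smul]
      rfl
    have hd := (differentiable_smoothTransition (u₁ (γ x) - u₂ (γ x) - ε)).hasDerivAt.comp x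
      (((hu h₁).sub (hu h₂)).sub_const ε)
    refine hd.congr_deriv ?_
    rcases mul_eq_zero.1 (truncatedGap_eq_zero hs hr h₁ h₂ hA hside (hγΩ hx)) with h | h
    · rw [h, zero_mul]
    · obtain ⟨g1, g2⟩ := gradient_eq_of_flux_eq_zero h
      rw [g1, g2, sub_self, mul_zero]
  obtain ⟨ρ, hρ, hρs⟩ := hside (min (grimHeight p - a) (b - grimHeight p))
    (lt_min (sub_pos.2 hy.1) (sub_pos.2 hy.2))
  obtain ⟨x₀, hx₀⟩ := exists_between (lt_min (hx.1.trans hx.2) (show s < s + ρ by linarith))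
  have hx₀' : x₀ ∈ Set.Ioo s r := ⟨hx₀.1, hx₀.2.trans_le (min_le_left _ _)⟩
  have hlt := hρs (γ x₀) (hγΩ hx₀') (by
    rw [hγτ]
    constructor
    · linarith [min_le_left (grimHeight p - a) (b - grimHeight p)]
    · linarith [min_le_right (grimHeight p - a) (b - grimHeight p)])
    (Or.inl (hx₀.2.trans_le (min_le_right _ _)))
  have hconst := isOpen_Ioo.is_const_of_deriv_eq_zero isPreconnected_Ioo
    (fun x hx => (hderiv hx).differentiableAt.differentiableWithinAt)
    (fun x hx => (hderiv hx).deriv) hx hx₀'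
  have hzero : Real.smoothTransition (u₁ (γ x₀) - u₂ (γ x₀) - ε) = 0 :=
    Real.smoothTransition.zero_of_nonpos (by linarith)
  rw [hγp, hzero] at hconst
  by_contra! h
  exact (Real.smoothTransition.pos_of_pos (show 0 < u₁ p - u₂ p - ε by linarith)).ne' hconst

end Comparison

/-- Uniqueness on the grim-reaper quadrilateral: two 1-translator solutions which extend
continuously with equal values on the relative interiors of the vertical sides and tend
to `+∞` on the grim-reaper arcs coincide. -/
theorem translator_uniqueness_quadrilateral (s r a b : ℝ)
    (hs : -(π/2) < s) (hsr : s < r) (hr : r < π/2) (hab : a < b)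
    (u₁ u₂ : ℝ × ℝ → ℝ)
    (h₁ : IsTranslator 1 (GRQuad s r a b) u₁)
    (h₂ : IsTranslator 1 (GRQuad s r a b) u₂)
    (v₁ v₂ : ℝ × ℝ → ℝ)
    (hv₁ : Set.EqOn v₁ u₁ (GRQuad s r a b)) (hv₂ : Set.EqOn v₂ u₂ (GRQuad s r a b))
    (hc₁ : ContinuousOn v₁ (GRQuad s r a b ∪ vertSegInt s a b ∪ vertSegInt r a b))
    (hc₂ : ContinuousOn v₂ (GRQuad s r a b ∪ vertSegInt s a b ∪ vertSegInt r a b))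
    (heq : Set.EqOn v₁ v₂ (vertSegInt s a b ∪ vertSegInt r a b))
    (hA₁ : ∀ q ∈ grimArcInt s r a ∪ grimArcInt s r b,
      Tendsto u₁ (𝓝[GRQuad s r a b] q) atTop)
    (hA₂ : ∀ q ∈ grimArcInt s r a ∪ grimArcInt s r b,
      Tendsto u₂ (𝓝[GRQuad s r a b] q) atTop) :
    Set.EqOn u₁ u₂ (GRQuad s r a b) := by
  intro p hp
  refine le_antisymm
    (translator_le (w := fun p => v₁ p - v₂ p) hs hr h₁ h₂
      (fun q hq => by simp only [hv₁ hq, hv₂ hq]) (hc₁.sub hc₂)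
      (fun q hq => sub_eq_zero.2 (heq hq)) hA₂ hp)
    (translator_le (w := fun p => v₂ p - v₁ p) hs hr h₂ h₁
      (fun q hq => by simp only [hv₁ hq, hv₂ hq]) (hc₂.sub hc₁)
      (fun q hq => sub_eq_zero.2 (heq hq).symm) hA₁ hp)
end

section
/- Necessity of the length balance: let −π/2 < s < r < π/2 and a < b, and suppose there exists a 1-translator solution u on the grim-reaper quadrilateral Ω_{s,r,a,b} such that u(p) → +∞ as p tends to any point of the relative interiors of the grim-reaper arcs A₁ and A₂, and u(p) → −∞ as p tends to any point of the relative interiors of the vertical segments C₁ and C₂. Then (e^b + e^a)(tan r − tan s) = (e^b − e^a)(sec r + sec s), i.e. the total e^t-weighted lengths of the arcs carrying boundary value +∞ and of the arcs carrying boundary value −∞ are equal. -/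
open Real Set Filter Topology

open MeasureTheory

/-- A smooth increasing step from `0` to `1`, located at height `M ^ 2` and with slope at
most `1 / M`. -/
noncomputable def smoothStep (M y : ℝ) : ℝ := 1 / 2 + arctan (y / M - M) / π

lemma smoothStep_pos (M y : ℝ) : 0 < smoothStep M y := by
  have h := div_lt_div_of_pos_right (neg_pi_div_two_lt_arctan (y / M - M)) pi_pos
  have h' : -(π / 2) / π = -(1 / 2) := by field_simp
  unfold smoothStep
  linarith

lemma smoothStep_lt_one (M y : ℝ) : smoothStep M y < 1 := by
  have h := div_lt_div_of_pos_right (arctan_lt_pi_div_two (y / M - M)) pi_pos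
  have h' : π / 2 / π = 1 / 2 := by field_simp
  unfold smoothStep
  linarith

lemma contDiff_smoothStep (M : ℝ) : ContDiff ℝ 1 (smoothStep M) := by
  exact contDiff_const.add ((contDiff_arctan.comp (by fun_prop)).div_const π)

lemma exists_hasDerivAt_smoothStep {M : ℝ} (hM : 0 < M) (y : ℝ) :
    ∃ d, HasDerivAt (smoothStep M) d y ∧ 0 ≤ d ∧ d ≤ 1 / M := by
  refine ⟨1 / (1 + (y / M - M) ^ 2) * (1 / M) / π, ?_, by positivity, ?_⟩
  · exact (((((hasDerivAt_id y).div_const M).sub_const M).arctan).div_const π).const_add _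
  · have h1 : 1 / (1 + (y / M - M) ^ 2) ≤ 1 := by
      rw [div_le_one (by positivity)]
      nlinarith [sq_nonneg (y / M - M)]
    have h2 : (0 : ℝ) < 1 / M := by positivity
    rw [div_le_iff₀ pi_pos]
    nlinarith [pi_gt_three]

lemma tendsto_smoothStep_atTop {M : ℝ} (hM : 0 < M) :
    Tendsto (smoothStep M) atTop (𝓝 1) := by
  have h1 : Tendsto (fun y : ℝ => y / M - M) atTop atTop :=
    tendsto_atTop_add_const_right _ _ (tendsto_id.atTop_div_const hM)
  have h2 := (((tendsto_arctan_atTop.mono_right nhdsWithin_le_nhds).comp h1).div_const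
    π).const_add (1 / 2)
  have h3 : 1 / 2 + π / 2 / π = 1 := by field_simp; norm_num
  rwa [h3] at h2

lemma tendsto_smoothStep_atBot {M : ℝ} (hM : 0 < M) :
    Tendsto (smoothStep M) atBot (𝓝 0) := by
  have h1 : Tendsto (fun y : ℝ => y / M - M) atBot atBot :=
    tendsto_atBot_add_const_right _ _ (tendsto_id.atBot_div_const hM)
  have h2 := (((tendsto_arctan_atBot.mono_right nhdsWithin_le_nhds).comp h1).div_const
    π).const_add (1 / 2)
  have h3 : 1 / 2 + -(π / 2) / π = 0 := by field_simp; norm_num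
  rwa [h3] at h2

lemma tendsto_smoothStep_param (y : ℝ) :
    Tendsto (fun M => smoothStep M y) atTop (𝓝 0) := by
  have h1 : Tendsto (fun M : ℝ => y / M - M) atTop atBot := by
    have := (tendsto_const_nhds (x := y)).div_atTop (tendsto_id (α := ℝ) (x := atTop))
    simpa [sub_eq_add_neg] using this.add_atBot tendsto_neg_atTop_atBot
  have h2 := (((tendsto_arctan_atBot.mono_right nhdsWithin_le_nhds).comp h1).div_const
    π).const_add (1 / 2)
  have h3 : 1 / 2 + -(π / 2) / π = 0 := by field_simp; norm_num
  rwa [h3] at h2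

/-- Dominated convergence for integrals over intervals shrinking from inside `(s, r)`. -/
lemma tendsto_intervalIntegral_shrink {s r C : ℝ} (hsr : s < r) {F : ℝ → ℝ → ℝ} {L : ℝ → ℝ}
    (hF : ∀ᶠ ε in 𝓝[>] (0 : ℝ), ContinuousOn (F ε) (Icc (s + ε) (r - ε)))
    (hC : ∀ᶠ ε in 𝓝[>] (0 : ℝ), ∀ x ∈ Icc (s + ε) (r - ε), |F ε x| ≤ C)
    (hL : ∀ x ∈ Ioo s r, Tendsto (fun ε => F ε x) (𝓝[>] 0) (𝓝 (L x))) :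
    Tendsto (fun ε => ∫ x in (s + ε)..(r - ε), F ε x) (𝓝[>] 0) (𝓝 (∫ x in s..r, L x)) := by
  have hpos : ∀ᶠ ε in 𝓝[>] (0 : ℝ), ε ∈ Ioo 0 ((r - s) / 2) :=
    Ioo_mem_nhdsGT (by linarith)
  have key : Tendsto
      (fun ε => ∫ x in Ioc s r, (Ioc (s + ε) (r - ε)).indicator (F ε) x) (𝓝[>] 0)
      (𝓝 (∫ x in Ioc s r, (Ioo s r).indicator L x)) := by
    refine tendsto_integral_filter_of_dominated_convergence (fun _ => |C|) ?_ ?_ ?_ ?_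
    · filter_upwards [hF] with ε h
      refine AEStronglyMeasurable.restrict ?_
      rw [aestronglyMeasurable_indicator_iff measurableSet_Ioc]
      exact (h.mono Ioc_subset_Icc_self).aestronglyMeasurable measurableSet_Ioc
    · filter_upwards [hC] with ε h
      refine Eventually.of_forall fun x => ?_
      by_cases hx : x ∈ Ioc (s + ε) (r - ε)
      · rw [indicator_of_mem hx]
        exact (h x (Ioc_subset_Icc_self hx)).trans (le_abs_self C)
      · rw [indicator_of_notMem hx]; simp
    · exact integrable_const _
    · have hr : ∀ᵐ x ∂(volume.restrict (Ioc s r)), x ≠ r := by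
        refine ae_restrict_of_ae ?_
        simp [ae_iff]
      filter_upwards [ae_restrict_mem measurableSet_Ioc, hr] with x hx hxr
      have hx' : x ∈ Ioo s r := ⟨hx.1, lt_of_le_of_ne hx.2 hxr⟩
      rw [indicator_of_mem hx']
      refine (hL x hx').congr' ?_
      have h1 : ∀ᶠ ε in 𝓝[>] (0 : ℝ), ε ∈ Ioo 0 (min (x - s) (r - x)) :=
        Ioo_mem_nhdsGT (lt_min (by linarith [hx'.1]) (by linarith [hx'.2]))
      filter_upwards [h1] with ε hε
      have := lt_min_iff.1 hε.2
      have hmem : x ∈ Ioc (s + ε) (r - ε) := ⟨by linarith, by linarith⟩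
      rw [indicator_of_mem hmem]
  have hlim : ∫ x in Ioc s r, (Ioo s r).indicator L x = ∫ x in s..r, L x := by
    rw [intervalIntegral.integral_of_le hsr.le, setIntegral_indicator measurableSet_Ioo,
      inter_eq_right.2 Ioo_subset_Ioc_self, integral_Ioc_eq_integral_Ioo]
  rw [← hlim]
  refine key.congr' ?_
  filter_upwards [hpos] with ε hε
  rw [intervalIntegral.integral_of_le (by linarith [hε.2]),
    setIntegral_indicator measurableSet_Ioc, inter_eq_right.2]
  exact Ioc_subset_Ioc (by linarith [hε.1]) (by linarith [hε.1])

/-- The flux of a divergence-free field `(P, Q)` through the boundary of a subrectangle,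
compared with a calibrating field `(Z₁, Z₂)` and weighted by a smooth step of `v`. -/
lemma subrectangle_flux_le {s r a b K D M : ℝ} {v P Q Z₁ Z₂ p q : ℝ × ℝ → ℝ}
    (hM : 0 < M) (hK : 0 ≤ K)
    (hv : ContDiffOn ℝ 1 v (Ioo s r ×ˢ Ioo a b))
    (hP : ContDiffOn ℝ 1 P (Ioo s r ×ˢ Ioo a b))
    (hQ : ContDiffOn ℝ 1 Q (Ioo s r ×ˢ Ioo a b))
    (hZ₁ : ContDiffOn ℝ 1 Z₁ (Ioo s r ×ˢ Ioo a b))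
    (hZ₂ : ContDiffOn ℝ 1 Z₂ (Ioo s r ×ˢ Ioo a b))
    (hp : ContinuousOn p (Ioo s r ×ˢ Ioo a b))
    (hq : ContinuousOn q (Ioo s r ×ˢ Ioo a b))
    (hdiv : ∀ z ∈ Ioo s r ×ˢ Ioo a b, fderiv ℝ P z (1, 0) + fderiv ℝ Q z (0, 1) = 0)
    (hPp : ∀ z ∈ Ioo s r ×ˢ Ioo a b, |P z| ≤ p z)
    (hQq : ∀ z ∈ Ioo s r ×ˢ Ioo a b, |Q z| ≤ q z)
    (hD : ∀ z ∈ Ioo s r ×ˢ Ioo a b, |fderiv ℝ Z₁ z (1, 0) + fderiv ℝ Z₂ z (0, 1)| ≤ D)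
    (hcal : ∀ z ∈ Ioo s r ×ˢ Ioo a b,
      Z₁ z * fderiv ℝ v z (1, 0) + Z₂ z * fderiv ℝ v z (0, 1) - K
        ≤ P z * fderiv ℝ v z (1, 0) + Q z * fderiv ℝ v z (0, 1))
    {x₁ x₂ t₁ t₂ : ℝ} (hx₁ : s < x₁) (hx : x₁ ≤ x₂) (hx₂ : x₂ < r)
    (ht₁ : a < t₁) (ht : t₁ ≤ t₂) (ht₂ : t₂ < b) :
    (∫ x in x₁..x₂, (smoothStep M (v (x, t₂)) * Z₂ (x, t₂)
        - (1 - smoothStep M (v (x, t₂))) * q (x, t₂)))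
      + (∫ x in x₁..x₂, (-(smoothStep M (v (x, t₁)) * Z₂ (x, t₁))
        - (1 - smoothStep M (v (x, t₁))) * q (x, t₁)))
      + (∫ y in t₁..t₂, (smoothStep M (v (x₂, y)) * Z₁ (x₂, y)
        - (1 - smoothStep M (v (x₂, y))) * p (x₂, y)))
      + (∫ y in t₁..t₂, (-(smoothStep M (v (x₁, y)) * Z₁ (x₁, y))
        - (1 - smoothStep M (v (x₁, y))) * p (x₁, y)))
      ≤ ∫ z in Ioo s r ×ˢ Ioo a b, (K / M + smoothStep M (v z) * D) := by
  set R : Set (ℝ × ℝ) := Ioo s r ×ˢ Ioo a b with hR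
  have hRo : IsOpen R := isOpen_Ioo.prod isOpen_Ioo
  have hsub : Icc (x₁, t₁) (x₂, t₂) ⊆ R := by
    rintro ⟨x, y⟩ ⟨⟨h1, h2⟩, ⟨h3, h4⟩⟩
    simp only at h1 h2 h3 h4
    exact ⟨⟨by linarith, by linarith⟩, ⟨by linarith, by linarith⟩⟩
  have hD0 : 0 ≤ D :=
    (abs_nonneg _).trans (hD (x₁, t₁) (hsub (left_mem_Icc.2 ⟨hx, ht⟩)))
  set w : ℝ × ℝ → ℝ := fun z => smoothStep M (v z) with hw
  have hwC : ContDiffOn ℝ 1 w R := (contDiff_smoothStep M).comp_contDiffOn hv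
  have hw0 : ∀ z, 0 ≤ w z := fun z => (smoothStep_pos M _).le
  have hw1 : ∀ z, w z ≤ 1 := fun z => (smoothStep_lt_one M _).le
  set F : ℝ × ℝ → ℝ := fun z => (w z - 1) * P z - w z * Z₁ z with hFdef
  set G : ℝ × ℝ → ℝ := fun z => (w z - 1) * Q z - w z * Z₂ z with hGdef
  have hF : ContDiffOn ℝ 1 F R := ((hwC.sub contDiffOn_const).mul hP).sub (hwC.mul hZ₁)
  have hG : ContDiffOn ℝ 1 G R := ((hwC.sub contDiffOn_const).mul hQ).sub (hwC.mul hZ₂)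
  have hdiff : ∀ {f : ℝ × ℝ → ℝ}, ContDiffOn ℝ 1 f R → ∀ z ∈ R, HasFDerivAt f (fderiv ℝ f z) z :=
    fun hf z hz => ((hf.contDiffAt (hRo.mem_nhds hz)).differentiableAt one_ne_zero).hasFDerivAt
  have hcdiv : ContinuousOn (fun z => fderiv ℝ F z (1, 0) + fderiv ℝ G z (0, 1)) R :=
    ((hF.continuousOn_fderiv_of_isOpen hRo le_rfl).clm_apply continuousOn_const).add
      ((hG.continuousOn_fderiv_of_isOpen hRo le_rfl).clm_apply continuousOn_const)
  have hIoo : Ioo (x₁, t₁).1 (x₂, t₂).1 ×ˢ Ioo (x₁, t₁).2 (x₂, t₂).2 ⊆ R := fun z hz =>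
    hsub ⟨⟨hz.1.1.le, hz.2.1.le⟩, ⟨hz.1.2.le, hz.2.2.le⟩⟩
  have hdivthm := integral_divergence_prod_Icc_of_hasFDerivAt_off_countable_of_le F G
    (fderiv ℝ F) (fderiv ℝ G) (x₁, t₁) (x₂, t₂) ⟨hx, ht⟩ ∅ countable_empty
    (hF.continuousOn.mono hsub) (hG.continuousOn.mono hsub)
    (fun z hz => hdiff hF z (hIoo hz.1)) (fun z hz => hdiff hG z (hIoo hz.1))
    ((hcdiv.mono hsub).integrableOn_compact isCompact_Icc)
  simp only at hdivthm
  have hptw : ∀ z ∈ R,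
      -(K / M + w z * D) ≤ fderiv ℝ F z (1, 0) + fderiv ℝ G z (0, 1) := by
    intro z hz
    obtain ⟨d, hd, hd0, hd1⟩ := exists_hasDerivAt_smoothStep hM (v z)
    have hwd : HasFDerivAt w (d • fderiv ℝ v z) z := hd.comp_hasFDerivAt z (hdiff hv z hz)
    have hFd := (((hwd.sub_const 1).mul (hdiff hP z hz)).sub (hwd.mul (hdiff hZ₁ z hz))).fderiv
    have hGd := (((hwd.sub_const 1).mul (hdiff hQ z hz)).sub (hwd.mul (hdiff hZ₂ z hz))).fderiv
    have e1 : fderiv ℝ F z = _ := hFd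
    have e2 : fderiv ℝ G z = _ := hGd
    rw [e1, e2]
    simp only [sub_apply, add_apply, smul_apply, smul_eq_mul]
    have c1 := mul_le_mul_of_nonneg_left (hcal z hz) hd0
    have c2 : K * d ≤ K * (1 / M) := mul_le_mul_of_nonneg_left hd1 hK
    have c3 := mul_le_mul_of_nonneg_left (le_of_abs_le (hD z hz)) (hw0 z)
    have c4 := congrArg (fun y => (w z - 1) * y) (hdiv z hz)
    simp only [mul_zero] at c4
    rw [mul_one_div] at c2
    linarith
  have hwInt : IntegrableOn (fun z => K / M + w z * D) R := by
    refine IntegrableOn.of_bound ?_ ?_ (K / M + D) ?_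
    · rw [hR, Measure.volume_eq_prod, Measure.prod_prod]
      simp [ENNReal.mul_lt_top]
    · exact (continuousOn_const.add (hwC.continuousOn.mul continuousOn_const)).aestronglyMeasurable
        hRo.measurableSet
    · refine Eventually.of_forall fun z => ?_
      have := mul_nonneg (hw0 z) hD0
      rw [norm_of_nonneg (by positivity)]
      nlinarith [hw1 z]
  have hlow : -∫ z in R, (K / M + w z * D)
      ≤ ∫ z in Icc (x₁, t₁) (x₂, t₂), (fderiv ℝ F z (1, 0) + fderiv ℝ G z (0, 1)) := by
    have h1 : ∫ z in Icc (x₁, t₁) (x₂, t₂), (K / M + w z * D) ≤ ∫ z in R, (K / M + w z * D) := by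
      refine setIntegral_mono_set hwInt (Eventually.of_forall fun z => ?_) hsub.eventuallyLE
      have := mul_nonneg (hw0 z) hD0
      simp only [Pi.zero_apply]
      positivity
    have h2 := setIntegral_mono_on (hwInt.mono_set hsub).neg
      ((hcdiv.mono hsub).integrableOn_compact (μ := volume) isCompact_Icc) measurableSet_Icc
      (fun z hz => hptw z (hsub hz))
    simp only [Pi.neg_apply, integral_neg] at h2
    linarith
  have hPa : ∀ z ∈ R, -p z ≤ P z ∧ P z ≤ p z := fun z hz => abs_le.1 (hPp z hz)
  have hQa : ∀ z ∈ R, -q z ≤ Q z ∧ Q z ≤ q z := fun z hz => abs_le.1 (hQq z hz)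
  have hmx : ∀ t, t₁ ≤ t → t ≤ t₂ → MapsTo (fun x : ℝ => (x, t)) (Icc x₁ x₂) R :=
    fun t h1 h2 x h => hsub ⟨⟨h.1, h1⟩, ⟨h.2, h2⟩⟩
  have hmy : ∀ x, x₁ ≤ x → x ≤ x₂ → MapsTo (fun y : ℝ => (x, y)) (Icc t₁ t₂) R :=
    fun x h1 h2 y h => hsub ⟨⟨h1, h.1⟩, ⟨h2, h.2⟩⟩
  have hix : ∀ t, t₁ ≤ t → t ≤ t₂ → ∀ {f : ℝ × ℝ → ℝ}, ContinuousOn f R →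
      IntervalIntegrable (fun x => f (x, t)) volume x₁ x₂ := fun t h1 h2 f hf =>
    (hf.comp (by fun_prop) (hmx t h1 h2)).intervalIntegrable_of_Icc hx
  have hiy : ∀ x, x₁ ≤ x → x ≤ x₂ → ∀ {f : ℝ × ℝ → ℝ}, ContinuousOn f R →
      IntervalIntegrable (fun y => f (x, y)) volume t₁ t₂ := fun x h1 h2 f hf =>
    (hf.comp (by fun_prop) (hmy x h1 h2)).intervalIntegrable_of_Icc ht
  have hc1 : ContinuousOn (fun z => w z * Z₂ z - (1 - w z) * q z) R :=
    (hwC.continuousOn.mul hZ₂.continuousOn).sub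
      ((continuousOn_const.sub hwC.continuousOn).mul hq)
  have hc2 : ContinuousOn (fun z => -(w z * Z₂ z) - (1 - w z) * q z) R :=
    (hwC.continuousOn.mul hZ₂.continuousOn).neg.sub
      ((continuousOn_const.sub hwC.continuousOn).mul hq)
  have hc3 : ContinuousOn (fun z => w z * Z₁ z - (1 - w z) * p z) R :=
    (hwC.continuousOn.mul hZ₁.continuousOn).sub
      ((continuousOn_const.sub hwC.continuousOn).mul hp)
  have hc4 : ContinuousOn (fun z => -(w z * Z₁ z) - (1 - w z) * p z) R :=
    (hwC.continuousOn.mul hZ₁.continuousOn).neg.sub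
      ((continuousOn_const.sub hwC.continuousOn).mul hp)
  have i1 := intervalIntegral.integral_mono_on hx (hix t₂ ht le_rfl hc1)
    (hix t₂ ht le_rfl hG.continuousOn.neg) (fun x h => by
      have hz := hmx t₂ ht le_rfl h
      simp only [hGdef, Pi.neg_apply]
      nlinarith [hQa _ hz, hw1 (x, t₂)])
  have i2 := intervalIntegral.integral_mono_on hx (hix t₁ le_rfl ht hc2)
    (hix t₁ le_rfl ht hG.continuousOn) (fun x h => by
      have hz := hmx t₁ le_rfl ht h
      simp only [hGdef]
      nlinarith [hQa _ hz, hw1 (x, t₁)])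
  have i3 := intervalIntegral.integral_mono_on ht (hiy x₂ hx le_rfl hc3)
    (hiy x₂ hx le_rfl hF.continuousOn.neg) (fun y h => by
      have hz := hmy x₂ hx le_rfl h
      simp only [hFdef, Pi.neg_apply]
      nlinarith [hPa _ hz, hw1 (x₂, y)])
  have i4 := intervalIntegral.integral_mono_on ht (hiy x₁ le_rfl hx hc4)
    (hiy x₁ le_rfl hx hF.continuousOn) (fun y h => by
      have hz := hmy x₁ le_rfl hx h
      simp only [hFdef]
      nlinarith [hPa _ hz, hw1 (x₁, y)])
  simp only [Pi.neg_apply, intervalIntegral.integral_neg] at i1 i3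
  linarith

/-- Convergence of weighted integrals along curves approaching a boundary arc on which the
weight has a constant limit. -/
lemma tendsto_integral_side {l m c : ℝ} (hlm : l < m) {R S : Set (ℝ × ℝ)} (hRS : R ⊆ S)
    (hS : IsCompact S) {γ : ℝ → ℝ → ℝ × ℝ} {γ₀ : ℝ → ℝ × ℝ} {w f g : ℝ × ℝ → ℝ}
    (hγ : ∀ᶠ ε in 𝓝[>] (0 : ℝ),
      ContinuousOn (γ ε) (Icc (l + ε) (m - ε)) ∧ MapsTo (γ ε) (Icc (l + ε) (m - ε)) R)
    (hγ₀ : ∀ x ∈ Ioo l m, Tendsto (fun ε => γ ε x) (𝓝[>] 0) (𝓝[R] γ₀ x))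
    (hγS : MapsTo γ₀ (Ioo l m) S)
    (hw : ContinuousOn w R) (hw0 : ∀ z, 0 ≤ w z) (hw1 : ∀ z, w z ≤ 1)
    (hwc : ∀ x ∈ Ioo l m, Tendsto w (𝓝[R] γ₀ x) (𝓝 c))
    (hf : ContinuousOn f S) (hg : ContinuousOn g S) :
    Tendsto (fun ε => ∫ x in (l + ε)..(m - ε),
        (w (γ ε x) * f (γ ε x) - (1 - w (γ ε x)) * g (γ ε x))) (𝓝[>] 0)
      (𝓝 (∫ x in l..m, (c * f (γ₀ x) - (1 - c) * g (γ₀ x)))) := by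
  obtain ⟨B₁, hB₁⟩ := hS.exists_bound_of_continuousOn hf
  obtain ⟨B₂, hB₂⟩ := hS.exists_bound_of_continuousOn hg
  refine tendsto_intervalIntegral_shrink (C := B₁ + B₂) hlm ?_ ?_ ?_
  · filter_upwards [hγ] with ε h
    have h1 : ContinuousOn (fun z => w z * f z - (1 - w z) * g z) R :=
      (hw.mul (hf.mono hRS)).sub ((continuousOn_const.sub hw).mul (hg.mono hRS))
    exact h1.comp h.1 h.2
  · filter_upwards [hγ] with ε h x hx
    have hz := hRS (h.2 hx)
    have h1 := abs_le.1 (hB₁ _ hz)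
    have h2 := abs_le.1 (hB₂ _ hz)
    have h3 := hw0 (γ ε x)
    have h4 := hw1 (γ ε x)
    rw [abs_le]
    constructor <;> nlinarith
  · intro x hx
    have h1 := (hwc x hx).comp (hγ₀ x hx)
    have h2 := ((hf _ (hγS hx)).mono_left (nhdsWithin_mono _ hRS)).comp (hγ₀ x hx)
    have h3 := ((hg _ (hγS hx)).mono_left (nhdsWithin_mono _ hRS)).comp (hγ₀ x hx)
    exact (h1.mul h2).sub ((tendsto_const_nhds.sub h1).mul h3)

/-- If `v` tends to `+∞` on the horizontal sides of a rectangle and to `-∞` on the vertical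
ones, then the flux of a calibrating field through the horizontal sides is at most the total
weighted length of the vertical sides. -/
lemma rectangle_flux_le {s r a b K : ℝ} (hsr : s < r) (hab : a < b) (hK : 0 ≤ K)
    {v P Q Z₁ Z₂ p q : ℝ × ℝ → ℝ}
    (hv : ContDiffOn ℝ 1 v (Ioo s r ×ˢ Ioo a b))
    (hP : ContDiffOn ℝ 1 P (Ioo s r ×ˢ Ioo a b))
    (hQ : ContDiffOn ℝ 1 Q (Ioo s r ×ˢ Ioo a b))
    (hZ₁ : ∀ z ∈ Icc s r ×ˢ Icc a b, ContDiffAt ℝ 1 Z₁ z)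
    (hZ₂ : ∀ z ∈ Icc s r ×ˢ Icc a b, ContDiffAt ℝ 1 Z₂ z)
    (hp : ContinuousOn p (Icc s r ×ˢ Icc a b))
    (hq : ContinuousOn q (Icc s r ×ˢ Icc a b))
    (hdiv : ∀ z ∈ Ioo s r ×ˢ Ioo a b, fderiv ℝ P z (1, 0) + fderiv ℝ Q z (0, 1) = 0)
    (hPp : ∀ z ∈ Ioo s r ×ˢ Ioo a b, |P z| ≤ p z)
    (hQq : ∀ z ∈ Ioo s r ×ˢ Ioo a b, |Q z| ≤ q z)
    (hcal : ∀ z ∈ Ioo s r ×ˢ Ioo a b,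
      Z₁ z * fderiv ℝ v z (1, 0) + Z₂ z * fderiv ℝ v z (0, 1) - K
        ≤ P z * fderiv ℝ v z (1, 0) + Q z * fderiv ℝ v z (0, 1))
    (htop : ∀ x ∈ Ioo s r, Tendsto v (𝓝[Ioo s r ×ˢ Ioo a b] (x, b)) atTop)
    (hbot : ∀ x ∈ Ioo s r, Tendsto v (𝓝[Ioo s r ×ˢ Ioo a b] (x, a)) atTop)
    (hleft : ∀ y ∈ Ioo a b, Tendsto v (𝓝[Ioo s r ×ˢ Ioo a b] (s, y)) atBot)
    (hright : ∀ y ∈ Ioo a b, Tendsto v (𝓝[Ioo s r ×ˢ Ioo a b] (r, y)) atBot) :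
    (∫ x in s..r, Z₂ (x, b)) - (∫ x in s..r, Z₂ (x, a))
      ≤ (∫ y in a..b, p (s, y)) + ∫ y in a..b, p (r, y) := by
  set R : Set (ℝ × ℝ) := Ioo s r ×ˢ Ioo a b with hR
  set S : Set (ℝ × ℝ) := Icc s r ×ˢ Icc a b with hSdef
  have hRo : IsOpen R := isOpen_Ioo.prod isOpen_Ioo
  have hS : IsCompact S := isCompact_Icc.prod isCompact_Icc
  have hRS : R ⊆ S := prod_mono Ioo_subset_Icc_self Ioo_subset_Icc_self
  have hZ₁R : ContDiffOn ℝ 1 Z₁ R := fun z hz => (hZ₁ z (hRS hz)).contDiffWithinAt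
  have hZ₂R : ContDiffOn ℝ 1 Z₂ R := fun z hz => (hZ₂ z (hRS hz)).contDiffWithinAt
  have hZ₁S : ContinuousOn Z₁ S := fun z hz => (hZ₁ z hz).continuousAt.continuousWithinAt
  have hZ₂S : ContinuousOn Z₂ S := fun z hz => (hZ₂ z hz).continuousAt.continuousWithinAt
  obtain ⟨D, hD⟩ : ∃ D, ∀ z ∈ S, |fderiv ℝ Z₁ z (1, 0) + fderiv ℝ Z₂ z (0, 1)| ≤ D := by
    have hc : ContinuousOn (fun z => fderiv ℝ Z₁ z (1, 0) + fderiv ℝ Z₂ z (0, 1)) S := by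
      intro z hz
      have c₁ : ContinuousAt (fderiv ℝ Z₁) z := (hZ₁ z hz).continuousAt_fderiv one_ne_zero
      have c₂ : ContinuousAt (fderiv ℝ Z₂) z := (hZ₂ z hz).continuousAt_fderiv one_ne_zero
      exact ((c₁.clm_apply continuousAt_const).add
        (c₂.clm_apply continuousAt_const)).continuousWithinAt
    exact hS.exists_bound_of_continuousOn hc
  have hsmall : ∀ᶠ ε in 𝓝[>] (0 : ℝ), 0 < ε ∧ ε < (r - s) / 2 ∧ ε < (b - a) / 2 := by
    have h1 : ∀ᶠ ε in 𝓝[>] (0 : ℝ), ε ∈ Ioo 0 ((r - s) / 2) := Ioo_mem_nhdsGT (by linarith)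
    have h2 : ∀ᶠ ε in 𝓝[>] (0 : ℝ), ε ∈ Ioo 0 ((b - a) / 2) := Ioo_mem_nhdsGT (by linarith)
    filter_upwards [h1, h2] with ε h1 h2 using ⟨h1.1, h1.2, h2.2⟩
  have hsub0 : ∀ y : ℝ, Tendsto (fun ε => y - ε) (𝓝[>] 0) (𝓝 y) := fun y => by
    have : Tendsto (fun ε : ℝ => y - ε) (𝓝 0) (𝓝 (y - 0)) :=
      Continuous.tendsto (by fun_prop) 0
    rw [sub_zero] at this
    exact this.mono_left nhdsWithin_le_nhds
  have hadd0 : ∀ y : ℝ, Tendsto (fun ε => y + ε) (𝓝[>] 0) (𝓝 y) := fun y => by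
    have : Tendsto (fun ε : ℝ => y + ε) (𝓝 0) (𝓝 (y + 0)) :=
      Continuous.tendsto (by fun_prop) 0
    rw [add_zero] at this
    exact this.mono_left nhdsWithin_le_nhds
  have key : ∀ M : ℝ, 0 < M →
      (∫ x in s..r, Z₂ (x, b)) - (∫ x in s..r, Z₂ (x, a))
        - (∫ y in a..b, p (r, y)) - (∫ y in a..b, p (s, y))
        ≤ ∫ z in R, (K / M + smoothStep M (v z) * D) := by
    intro M hM
    have hw : ContinuousOn (fun z => smoothStep M (v z)) R :=
      (contDiff_smoothStep M).continuous.comp_continuousOn hv.continuousOn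
    have hw0 : ∀ z, 0 ≤ smoothStep M (v z) := fun z => (smoothStep_pos M _).le
    have hw1 : ∀ z, smoothStep M (v z) ≤ 1 := fun z => (smoothStep_lt_one M _).le
    have l1 := tendsto_integral_side hsr hRS hS (γ := fun ε x => (x, b - ε))
      (γ₀ := fun x => (x, b)) (w := fun z => smoothStep M (v z)) (f := Z₂) (g := q) (c := 1)
      (by
        filter_upwards [hsmall] with ε h
        exact ⟨by fun_prop, fun x hx =>
          ⟨⟨by linarith [hx.1], by linarith [hx.2]⟩, ⟨by linarith, by linarith⟩⟩⟩)
      (fun x hx => tendsto_nhdsWithin_iff.2 ⟨tendsto_const_nhds.prodMk_nhds (hsub0 b), by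
        filter_upwards [hsmall] with ε h
        exact ⟨hx, ⟨by linarith, by linarith⟩⟩⟩)
      (fun x hx => ⟨Ioo_subset_Icc_self hx, right_mem_Icc.2 hab.le⟩) hw hw0 hw1
      (fun x hx => (tendsto_smoothStep_atTop hM).comp (htop x hx)) hZ₂S hq
    have l2 := tendsto_integral_side hsr hRS hS (γ := fun ε x => (x, a + ε))
      (γ₀ := fun x => (x, a)) (w := fun z => smoothStep M (v z)) (f := -Z₂) (g := q) (c := 1)
      (by
        filter_upwards [hsmall] with ε h
        exact ⟨by fun_prop, fun x hx =>
          ⟨⟨by linarith [hx.1], by linarith [hx.2]⟩, ⟨by linarith, by linarith⟩⟩⟩)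
      (fun x hx => tendsto_nhdsWithin_iff.2 ⟨tendsto_const_nhds.prodMk_nhds (hadd0 a), by
        filter_upwards [hsmall] with ε h
        exact ⟨hx, ⟨by linarith, by linarith⟩⟩⟩)
      (fun x hx => ⟨Ioo_subset_Icc_self hx, left_mem_Icc.2 hab.le⟩) hw hw0 hw1
      (fun x hx => (tendsto_smoothStep_atTop hM).comp (hbot x hx)) hZ₂S.neg hq
    have l3 := tendsto_integral_side hab hRS hS (γ := fun ε y => (r - ε, y))
      (γ₀ := fun y => (r, y)) (w := fun z => smoothStep M (v z)) (f := Z₁) (g := p) (c := 0)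
      (by
        filter_upwards [hsmall] with ε h
        exact ⟨by fun_prop, fun x hx =>
          ⟨⟨by linarith, by linarith⟩, ⟨by linarith [hx.1], by linarith [hx.2]⟩⟩⟩)
      (fun x hx => tendsto_nhdsWithin_iff.2 ⟨(hsub0 r).prodMk_nhds tendsto_const_nhds, by
        filter_upwards [hsmall] with ε h
        exact ⟨⟨by linarith, by linarith⟩, hx⟩⟩)
      (fun x hx => ⟨right_mem_Icc.2 hsr.le, Ioo_subset_Icc_self hx⟩) hw hw0 hw1
      (fun x hx => (tendsto_smoothStep_atBot hM).comp (hright x hx)) hZ₁S hp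
    have l4 := tendsto_integral_side hab hRS hS (γ := fun ε y => (s + ε, y))
      (γ₀ := fun y => (s, y)) (w := fun z => smoothStep M (v z)) (f := -Z₁) (g := p) (c := 0)
      (by
        filter_upwards [hsmall] with ε h
        exact ⟨by fun_prop, fun x hx =>
          ⟨⟨by linarith, by linarith⟩, ⟨by linarith [hx.1], by linarith [hx.2]⟩⟩⟩)
      (fun x hx => tendsto_nhdsWithin_iff.2 ⟨(hadd0 s).prodMk_nhds tendsto_const_nhds, by
        filter_upwards [hsmall] with ε h
        exact ⟨⟨by linarith, by linarith⟩, hx⟩⟩)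
      (fun x hx => ⟨left_mem_Icc.2 hsr.le, Ioo_subset_Icc_self hx⟩) hw hw0 hw1
      (fun x hx => (tendsto_smoothStep_atBot hM).comp (hleft x hx)) hZ₁S.neg hp
    have hle := le_of_tendsto (((l1.add l2).add l3).add l4) (by
      filter_upwards [hsmall] with ε h
      have := subrectangle_flux_le hM hK hv hP hQ hZ₁R hZ₂R (hp.mono hRS) (hq.mono hRS) hdiv
        hPp hQq (fun z hz => hD z (hRS hz)) hcal (x₁ := s + ε) (x₂ := r - ε) (t₁ := a + ε)
        (t₂ := b - ε) (by linarith) (by linarith) (by linarith) (by linarith) (by linarith)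
        (by linarith)
      simp only [Pi.neg_apply, mul_neg]
      exact this)
    simp only [Pi.neg_apply, mul_neg, one_mul, sub_self, zero_mul, sub_zero, neg_zero, zero_sub,
      intervalIntegral.integral_neg] at hle
    linarith
  have hlim : Tendsto (fun M => ∫ z in R, (K / M + smoothStep M (v z) * D)) atTop (𝓝 0) := by
    have h0 : ∫ z in R, (0 : ℝ) = 0 := by simp
    rw [← h0]
    refine tendsto_integral_filter_of_dominated_convergence (fun _ => K + |D|) ?_ ?_ ?_ ?_
    · refine Eventually.of_forall fun M => ?_
      exact (continuousOn_const.add (((contDiff_smoothStep M).continuous.comp_continuousOn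
        hv.continuousOn).mul continuousOn_const)).aestronglyMeasurable hRo.measurableSet
    · filter_upwards [eventually_ge_atTop 1] with M hM
      refine Eventually.of_forall fun z => (norm_add_le _ _).trans (add_le_add ?_ ?_)
      · rw [norm_of_nonneg (by positivity)]
        exact div_le_self hK hM
      · rw [norm_mul, norm_of_nonneg (smoothStep_pos M _).le]
        exact mul_le_of_le_one_left (norm_nonneg _) (smoothStep_lt_one M _).le
    · refine integrableOn_const ?_
      rw [hR, Measure.volume_eq_prod, Measure.prod_prod]
      exact (ENNReal.mul_lt_top (by simp) (by simp)).ne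
    · refine Eventually.of_forall fun z => ?_
      have h1 : Tendsto (fun M : ℝ => K / M) atTop (𝓝 0) :=
        tendsto_const_nhds.div_atTop tendsto_id
      simpa using h1.add ((tendsto_smoothStep_param (v z)).mul_const D)
  have := ge_of_tendsto hlim ((eventually_gt_atTop 0).mono key)
  linarith

/-- If `v` tends to `+∞` on the horizontal sides of a rectangle and to `-∞` on the vertical
ones, then the flux of a calibrating field through the vertical sides is at most the total
weighted length of the horizontal sides. -/
lemma rectangle_flux_le' {s r a b K : ℝ} (hsr : s < r) (hab : a < b) (hK : 0 ≤ K)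
    {v P Q Z₁ Z₂ p q : ℝ × ℝ → ℝ}
    (hv : ContDiffOn ℝ 1 v (Ioo s r ×ˢ Ioo a b))
    (hP : ContDiffOn ℝ 1 P (Ioo s r ×ˢ Ioo a b))
    (hQ : ContDiffOn ℝ 1 Q (Ioo s r ×ˢ Ioo a b))
    (hZ₁ : ∀ z ∈ Icc s r ×ˢ Icc a b, ContDiffAt ℝ 1 Z₁ z)
    (hZ₂ : ∀ z ∈ Icc s r ×ˢ Icc a b, ContDiffAt ℝ 1 Z₂ z)
    (hp : ContinuousOn p (Icc s r ×ˢ Icc a b))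
    (hq : ContinuousOn q (Icc s r ×ˢ Icc a b))
    (hdiv : ∀ z ∈ Ioo s r ×ˢ Ioo a b, fderiv ℝ P z (1, 0) + fderiv ℝ Q z (0, 1) = 0)
    (hPp : ∀ z ∈ Ioo s r ×ˢ Ioo a b, |P z| ≤ p z)
    (hQq : ∀ z ∈ Ioo s r ×ˢ Ioo a b, |Q z| ≤ q z)
    (hcal : ∀ z ∈ Ioo s r ×ˢ Ioo a b,
      -(Z₁ z * fderiv ℝ v z (1, 0) + Z₂ z * fderiv ℝ v z (0, 1)) - K
        ≤ P z * fderiv ℝ v z (1, 0) + Q z * fderiv ℝ v z (0, 1))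
    (htop : ∀ x ∈ Ioo s r, Tendsto v (𝓝[Ioo s r ×ˢ Ioo a b] (x, b)) atTop)
    (hbot : ∀ x ∈ Ioo s r, Tendsto v (𝓝[Ioo s r ×ˢ Ioo a b] (x, a)) atTop)
    (hleft : ∀ y ∈ Ioo a b, Tendsto v (𝓝[Ioo s r ×ˢ Ioo a b] (s, y)) atBot)
    (hright : ∀ y ∈ Ioo a b, Tendsto v (𝓝[Ioo s r ×ˢ Ioo a b] (r, y)) atBot) :
    (∫ y in a..b, Z₁ (r, y)) - (∫ y in a..b, Z₁ (s, y))
      ≤ (∫ x in s..r, q (x, a)) + ∫ x in s..r, q (x, b) := by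
  have hmap : MapsTo Prod.swap (Ioo a b ×ˢ Ioo s r) (Ioo s r ×ˢ Ioo a b) :=
    fun z hz => ⟨hz.2, hz.1⟩
  have hmapS : MapsTo Prod.swap (Icc a b ×ˢ Icc s r) (Icc s r ×ˢ Icc a b) :=
    fun z hz => ⟨hz.2, hz.1⟩
  have hsw : ContDiff ℝ 1 (Prod.swap : ℝ × ℝ → ℝ × ℝ) := contDiff_snd.prodMk contDiff_fst
  have hfd : ∀ (f : ℝ × ℝ → ℝ) (z h : ℝ × ℝ),
      fderiv ℝ (fun z => f z.swap) z h = fderiv ℝ f z.swap h.swap := fun f z h => by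
    have := (ContinuousLinearEquiv.prodComm ℝ ℝ ℝ).comp_right_fderiv (f := f) (x := z)
    exact congrArg (fun L => L h) this
  have hfdn : ∀ (f : ℝ × ℝ → ℝ) (z h : ℝ × ℝ),
      fderiv ℝ (fun z => -f z.swap) z h = -fderiv ℝ f z.swap h.swap := fun f z h => by
    rw [fderiv_fun_neg, neg_apply, hfd]
  have hlim : ∀ {z : ℝ × ℝ} {l l' : Filter ℝ}, Tendsto v (𝓝[Ioo s r ×ˢ Ioo a b] z) l →
      Tendsto (fun y : ℝ => -y) l l' →
      Tendsto (fun z => -v z.swap) (𝓝[Ioo a b ×ˢ Ioo s r] z.swap) l' := fun {z l l'} h hl => by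
    refine hl.comp (h.comp ?_)
    have := (hsw.continuous.continuousAt (x := z.swap)).continuousWithinAt
      (s := Ioo a b ×ˢ Ioo s r) |>.tendsto_nhdsWithin hmap
    rwa [Prod.swap_swap] at this
  exact rectangle_flux_le hab hsr hK (v := fun z => -v z.swap) (P := fun z => -Q z.swap)
    (Q := fun z => -P z.swap) (Z₁ := fun z => Z₂ z.swap) (Z₂ := fun z => Z₁ z.swap)
    (p := fun z => q z.swap) (q := fun z => p z.swap)
    (hv.comp hsw.contDiffOn hmap).neg (hQ.comp hsw.contDiffOn hmap).neg
    (hP.comp hsw.contDiffOn hmap).neg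
    (fun z hz => (hZ₂ _ (hmapS hz)).comp z hsw.contDiffAt)
    (fun z hz => (hZ₁ _ (hmapS hz)).comp z hsw.contDiffAt)
    (hq.comp hsw.continuous.continuousOn hmapS) (hp.comp hsw.continuous.continuousOn hmapS)
    (fun z hz => by
      have := hdiv _ (hmap hz)
      rw [hfdn, hfdn]
      simp only [Prod.swap_prod_mk]
      linarith)
    (fun z hz => by rw [abs_neg]; exact hQq _ (hmap hz))
    (fun z hz => by rw [abs_neg]; exact hPp _ (hmap hz))
    (fun z hz => by
      have := hcal _ (hmap hz)
      rw [hfdn, hfdn]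
      simp only [Prod.swap_prod_mk]
      linarith)
    (fun x hx => hlim (hright x hx) tendsto_neg_atBot_atTop)
    (fun x hx => hlim (hleft x hx) tendsto_neg_atBot_atTop)
    (fun x hx => hlim (hbot x hx) tendsto_neg_atTop_atBot)
    (fun x hx => hlim (htop x hx) tendsto_neg_atTop_atBot)

/-- The shear straightening the grim reaper arcs. -/
noncomputable def grimShear (z : ℝ × ℝ) : ℝ × ℝ := (z.1, z.2 - log (cos z.1))

lemma hasFDerivAt_grimShear {z : ℝ × ℝ} (hz : 0 < cos z.1) :
    HasFDerivAt grimShear ((ContinuousLinearMap.fst ℝ ℝ ℝ).prod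
      (ContinuousLinearMap.snd ℝ ℝ ℝ + tan z.1 • ContinuousLinearMap.fst ℝ ℝ ℝ)) z := by
  have h1 : HasDerivAt (fun x => -log (cos x)) (tan z.1) z.1 := by
    have := ((hasDerivAt_cos z.1).log hz.ne').neg
    rwa [neg_div, neg_neg, ← tan_eq_sin_div_cos] at this
  have h2 := h1.comp_hasFDerivAt z (hasFDerivAt_fst (𝕜 := ℝ) (p := z))
  have h3 := hasFDerivAt_fst.prodMk (hasFDerivAt_snd.add h2)
  exact h3

lemma fderiv_comp_grimShear {f : ℝ × ℝ → ℝ} {z : ℝ × ℝ} (hz : 0 < cos z.1)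
    (hf : DifferentiableAt ℝ f (grimShear z)) :
    fderiv ℝ (fun z => f (grimShear z)) z (1, 0)
        = pdx f (grimShear z) + tan z.1 * pdt f (grimShear z) ∧
      fderiv ℝ (fun z => f (grimShear z)) z (0, 1) = pdt f (grimShear z) := by
  have h := (hf.hasFDerivAt.comp z (hasFDerivAt_grimShear hz)).fderiv
  have h' : fderiv ℝ (fun z => f (grimShear z)) z = _ := h
  have e : ((1 : ℝ), tan z.1) = (1, 0) + tan z.1 • ((0 : ℝ), (1 : ℝ)) := by simp
  rw [h']
  constructor
  · simp only [ContinuousLinearMap.comp_apply, ContinuousLinearMap.prod_apply, add_apply,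
      smul_apply, ContinuousLinearMap.coe_fst', ContinuousLinearMap.coe_snd', smul_eq_mul,
      zero_add, mul_one]
    rw [e, map_add, map_smul, smul_eq_mul]
    rfl
  · simp [pdt]

/-- The weighted flux density `e ^ t * g / √(1 + |∇u|²)`. -/
noncomputable def fluxDensity (u g : ℝ × ℝ → ℝ) (p : ℝ × ℝ) : ℝ :=
  exp p.2 * g p / √(1 + pdx u p ^ 2 + pdt u p ^ 2)

lemma contDiffOn_fluxDensity {u g : ℝ × ℝ → ℝ} {Ω : Set (ℝ × ℝ)}
    (hx : ContDiffOn ℝ 1 (pdx u) Ω) (ht : ContDiffOn ℝ 1 (pdt u) Ω) (hg : ContDiffOn ℝ 1 g Ω) :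
    ContDiffOn ℝ 1 (fluxDensity u g) Ω := by
  have hpos : ∀ p, 0 < 1 + pdx u p ^ 2 + pdt u p ^ 2 := fun p => by positivity
  refine ((contDiff_exp.comp_contDiffOn contDiffOn_snd).mul hg).div ?_
    fun p _ => (sqrt_pos.2 (hpos p)).ne'
  exact ((contDiffOn_const.add (hx.pow 2)).add (ht.pow 2)).sqrt fun p _ => (hpos p).ne'

lemma contDiffOn_pdx {u : ℝ × ℝ → ℝ} {Ω : Set (ℝ × ℝ)} (hΩ : IsOpen Ω)
    (hu : ContDiffOn ℝ 2 u Ω) : ContDiffOn ℝ 1 (pdx u) Ω :=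
  (hu.fderiv_of_isOpen hΩ (by norm_num)).clm_apply contDiffOn_const

lemma contDiffOn_pdt {u : ℝ × ℝ → ℝ} {Ω : Set (ℝ × ℝ)} (hΩ : IsOpen Ω)
    (hu : ContDiffOn ℝ 2 u Ω) : ContDiffOn ℝ 1 (pdt u) Ω :=
  (hu.fderiv_of_isOpen hΩ (by norm_num)).clm_apply contDiffOn_const

lemma pdt_pdx_eq {u : ℝ × ℝ → ℝ} {p : ℝ × ℝ} (hu : ContDiffAt ℝ 2 u p) :
    pdt (pdx u) p = pdx (pdt u) p := by
  have h := hu.isSymmSndFDerivAt (by simp)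
  have hd : DifferentiableAt ℝ (fderiv ℝ u) p :=
    (hu.fderiv_right (m := 1) (by norm_num)).differentiableAt one_ne_zero
  have e : ∀ v w : ℝ × ℝ, fderiv ℝ (fun q => fderiv ℝ u q v) p w
      = fderiv ℝ (fderiv ℝ u) p w v := fun v w => by
    rw [fderiv_clm_apply hd (differentiableAt_const _)]
    simp
  exact (e _ _).trans ((h.eq _ _).trans (e _ _).symm)

/-- The divergence form of the translator equation. -/
lemma IsTranslator.divergence_eq_zero {u : ℝ × ℝ → ℝ} {Ω : Set (ℝ × ℝ)} (hΩ : IsOpen Ω)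
    (hu : IsTranslator 1 Ω u) {p : ℝ × ℝ} (hp : p ∈ Ω) :
    pdx (fluxDensity u (pdx u)) p + pdt (fluxDensity u (pdt u)) p = 0 := by
  have hdx := (((contDiffOn_pdx hΩ hu.1).contDiffAt (hΩ.mem_nhds hp)).differentiableAt
    one_ne_zero).hasFDerivAt
  have hdt := (((contDiffOn_pdt hΩ hu.1).contDiffAt (hΩ.mem_nhds hp)).differentiableAt
    one_ne_zero).hasFDerivAt
  have hsymm := pdt_pdx_eq (hu.1.contDiffAt (hΩ.mem_nhds hp))
  have hpos : 0 < 1 + pdx u p ^ 2 + pdt u p ^ 2 := by positivity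
  have hE := (hasDerivAt_exp p.2).comp_hasFDerivAt p (hasFDerivAt_snd (𝕜 := ℝ) (p := p))
  have hWi := ((hasDerivAt_inv (sqrt_pos.2 hpos).ne').comp _
    (hasDerivAt_sqrt hpos.ne')).comp_hasFDerivAt p
    (((hasFDerivAt_const (1 : ℝ) p).add (hdx.pow 2)).add (hdt.pow 2))
  have h1 := ((hE.mul hdx).mul hWi).fderiv
  have h2 := ((hE.mul hdt).mul hWi).fderiv
  have h1' : fderiv ℝ (fluxDensity u (pdx u)) p = _ := h1
  have h2' : fderiv ℝ (fluxDensity u (pdt u)) p = _ := h2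
  have hpde := hu.2 p hp
  have exx : fderiv ℝ (pdx u) p (1, 0) = pdx (pdx u) p := rfl
  have etx : fderiv ℝ (pdx u) p (0, 1) = pdx (pdt u) p := hsymm
  have ext : fderiv ℝ (pdt u) p (1, 0) = pdx (pdt u) p := rfl
  have ett : fderiv ℝ (pdt u) p (0, 1) = pdt (pdt u) p := rfl
  have g1 : pdx (fluxDensity u (pdx u)) p = fderiv ℝ (fluxDensity u (pdx u)) p (1, 0) := rfl
  have g2 : pdt (fluxDensity u (pdt u)) p = fderiv ℝ (fluxDensity u (pdt u)) p (0, 1) := rfl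
  rw [g1, g2, h1', h2']
  simp only [add_apply, smul_apply, smul_eq_mul, exx, etx, ext, ett, Function.comp_apply,
    ContinuousLinearMap.coe_snd', zero_apply, Pi.add_apply, Pi.mul_apply]
  set A := pdx u p
  set B := pdt u p
  obtain ⟨W, hW, hWpos⟩ : ∃ W, √(1 + A ^ 2 + B ^ 2) = W ∧ 0 < W := ⟨_, rfl, sqrt_pos.2 hpos⟩
  have hW2 : W ^ 2 = 1 + A ^ 2 + B ^ 2 := by rw [← hW, sq_sqrt hpos.le]
  rw [hW]
  field_simp
  rw [hW2]
  simp only [nsmul_eq_mul, Nat.cast_ofNat, Nat.add_one_sub_one, pow_one]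
  linear_combination 2 * rexp p.2 * hpde

/-- `A² + B² ≥ (L - 1) √(1 + A² + B²)` whenever `L` is at most the length of `(A, B)`. -/
lemma sub_one_le_div_sqrt {A B L : ℝ} (hL : L ≤ √(A ^ 2 + B ^ 2)) :
    L - 1 ≤ (A ^ 2 + B ^ 2) / √(1 + A ^ 2 + B ^ 2) := by
  have hpos : 0 < 1 + A ^ 2 + B ^ 2 := by positivity
  have hW := sqrt_pos.2 hpos
  have hle : √(A ^ 2 + B ^ 2) ≤ √(1 + A ^ 2 + B ^ 2) := sqrt_le_sqrt (by linarith)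
  have hsq := sq_sqrt hpos.le
  have h1 : 1 ≤ √(1 + A ^ 2 + B ^ 2) := one_le_sqrt.2 (by nlinarith [sq_nonneg A, sq_nonneg B])
  rw [le_div_iff₀ hW]
  nlinarith

lemma abs_unit_combination_le {A B k c d : ℝ} (hk : |k| ≤ 1) (hcd : c ^ 2 + d ^ 2 = 1) :
    |k * (c * A + d * B)| ≤ √(A ^ 2 + B ^ 2) := by
  refine abs_le_sqrt ?_
  have hk2 : k ^ 2 ≤ 1 := (sq_le_one_iff_abs_le_one k).2 hk
  have h1 : (c * A + d * B) ^ 2 ≤ A ^ 2 + B ^ 2 := by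
    have : A ^ 2 + B ^ 2 = (c ^ 2 + d ^ 2) * (A ^ 2 + B ^ 2) := by rw [hcd, one_mul]
    rw [this]
    nlinarith [sq_nonneg (c * B - d * A)]
  rw [mul_pow]
  nlinarith [sq_nonneg (c * A + d * B)]

/-- The affine function from `-1` at `l` to `1` at `m` is bounded by `1` in between. -/
lemma abs_affine_le_one {l m x : ℝ} (hx : x ∈ Ioo l m) :
    |(2 * x - l - m) / (m - l)| ≤ 1 := by
  have := hx.1
  have := hx.2
  rw [abs_le, div_le_iff₀ (by linarith), le_div_iff₀ (by linarith)]
  constructor <;> linarith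

lemma integral_inv_cos_sq_of_mem {s r : ℝ} (hs : -(π / 2) < s) (hsr : s < r) (hr : r < π / 2) :
    ∫ x in s..r, 1 / cos x ^ 2 = tan r - tan s := by
  have hcos : ∀ x ∈ uIcc s r, cos x ≠ 0 := fun x hx => by
    rw [uIcc_of_le hsr.le] at hx
    exact (cos_pos_of_mem_Ioo ⟨by linarith [hx.1], by linarith [hx.2]⟩).ne'
  refine intervalIntegral.integral_eq_sub_of_hasDerivAt (fun x hx => hasDerivAt_tan (hcos x hx))
    (ContinuousOn.intervalIntegrable ?_)
  exact continuousOn_const.div (by fun_prop) fun x hx => pow_ne_zero 2 (hcos x hx)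

/-- Necessity of the length balance: if a 1-translator solution on the grim-reaper
quadrilateral tends to `+∞` on the grim-reaper arcs and to `-∞` on the vertical sides,
then the total e^t-weighted lengths of the arcs carrying boundary value `+∞` and of the
arcs carrying boundary value `-∞` are equal. -/
theorem length_balance_necessity (s r a b : ℝ)
    (hs : -(π/2) < s) (hsr : s < r) (hr : r < π/2) (hab : a < b)
    (u : ℝ × ℝ → ℝ) (hu : IsTranslator 1 (GRQuad s r a b) u)
    (hA : ∀ q ∈ grimArcInt s r a ∪ grimArcInt s r b,
      Tendsto u (𝓝[GRQuad s r a b] q) atTop)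
    (hC : ∀ q ∈ vertSegInt s a b ∪ vertSegInt r a b,
      Tendsto u (𝓝[GRQuad s r a b] q) atBot) :
    (Real.exp b + Real.exp a) * (Real.tan r - Real.tan s)
      = (Real.exp b - Real.exp a) * (1 / Real.cos r + 1 / Real.cos s) := by
  set Ω := GRQuad s r a b with hΩdef
  have hcos : ∀ x ∈ Icc s r, 0 < cos x := fun x hx =>
    cos_pos_of_mem_Ioo ⟨by linarith [hx.1], by linarith [hx.2]⟩
  have hcosR : ∀ z ∈ Ioo s r ×ˢ Ioo a b, 0 < cos z.1 := fun z hz =>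
    hcos _ (Ioo_subset_Icc_self hz.1)
  have hmap : MapsTo grimShear (Ioo s r ×ˢ Ioo a b) Ω := fun z hz =>
    ⟨hz.1.1, hz.1.2, sub_lt_sub_right hz.2.1 _, sub_lt_sub_right hz.2.2 _⟩
  have hΩ : IsOpen Ω := by
    have hcurve : ContinuousOn (fun p : ℝ × ℝ => (p.1, p.2 + log (cos p.1)))
        (Ioo s r ×ˢ univ) := by
      refine continuousOn_fst.prodMk (continuousOn_snd.add (ContinuousOn.log (by fun_prop) ?_))
      exact fun p hp => (hcos _ (Ioo_subset_Icc_self hp.1)).ne'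
    convert hcurve.isOpen_inter_preimage (isOpen_Ioo.prod isOpen_univ)
      (isOpen_Ioo.prod isOpen_Ioo : IsOpen (Ioo s r ×ˢ Ioo a b)) using 1
    ext p
    simp only [hΩdef, GRQuad, mem_ofPred_eq, mem_inter_iff, mem_prod, mem_univ, mem_preimage,
      mem_Ioo, and_true, sub_lt_iff_lt_add, lt_sub_iff_add_lt]
    tauto
  have hΦ : ContDiffOn ℝ 2 grimShear (Ioo s r ×ˢ Ioo a b) :=
    contDiffOn_fst.prodMk (contDiffOn_snd.sub
      ((contDiff_cos.comp_contDiffOn contDiffOn_fst).log fun z hz => (hcosR z hz).ne'))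
  have hcont : ∀ z : ℝ × ℝ, z.1 ∈ Icc s r → ∀ l : Filter ℝ, Tendsto u (𝓝[Ω] grimShear z) l →
      Tendsto (fun z => u (grimShear z)) (𝓝[Ioo s r ×ˢ Ioo a b] z) l := fun z hz l h =>
    h.comp (((hasFDerivAt_grimShear (hcos _ hz)).continuousAt.continuousWithinAt
      ).tendsto_nhdsWithin hmap)
  have hux := contDiffOn_pdx hΩ hu.1
  have hut := contDiffOn_pdt hΩ hu.1
  have hX₁ := contDiffOn_fluxDensity hux hut hux
  have hX₂ := contDiffOn_fluxDensity hux hut hut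
  have hdiff : ∀ {n : WithTop ℕ∞} {f : ℝ × ℝ → ℝ}, n ≠ 0 → ContDiffOn ℝ n f Ω →
      ∀ z ∈ Ioo s r ×ˢ Ioo a b, DifferentiableAt ℝ f (grimShear z) := fun hn hf z hz =>
    (hf.contDiffAt (hΩ.mem_nhds (hmap hz))).differentiableAt hn
  set P : ℝ × ℝ → ℝ := fun z => fluxDensity u (pdx u) (grimShear z) with hPdef
  set Q : ℝ × ℝ → ℝ := fun z => fluxDensity u (pdt u) (grimShear z) - tan z.1 * P z with hQdef
  have htan : ∀ z : ℝ × ℝ, 0 < cos z.1 → ContDiffAt ℝ 1 (fun z : ℝ × ℝ => tan z.1) z :=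
    fun z hz => (contDiffAt_tan.2 hz.ne').comp z contDiffAt_fst
  have hv : ContDiffOn ℝ 1 (fun z => u (grimShear z)) (Ioo s r ×ˢ Ioo a b) :=
    (hu.1.comp hΦ hmap).of_le (by norm_num)
  have hP : ContDiffOn ℝ 1 P (Ioo s r ×ˢ Ioo a b) := hX₁.comp (hΦ.of_le (by norm_num)) hmap
  have hQ : ContDiffOn ℝ 1 Q (Ioo s r ×ˢ Ioo a b) :=
    (hX₂.comp (hΦ.of_le (by norm_num)) hmap).sub
      (ContDiffOn.mul (fun z hz => (htan z (hcosR z hz)).contDiffWithinAt) hP)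
  have hdiv : ∀ z ∈ Ioo s r ×ˢ Ioo a b,
      fderiv ℝ P z (1, 0) + fderiv ℝ Q z (0, 1) = 0 := by
    intro z hz
    have hRz : Ioo s r ×ˢ Ioo a b ∈ 𝓝 z := (isOpen_Ioo.prod isOpen_Ioo).mem_nhds hz
    have h1 := fderiv_comp_grimShear (hcosR z hz) (hdiff one_ne_zero hX₁ z hz)
    have h2 := fderiv_comp_grimShear (hcosR z hz) (hdiff one_ne_zero hX₂ z hz)
    have hX₂d : DifferentiableAt ℝ (fun z => fluxDensity u (pdt u) (grimShear z)) z :=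
      ((hX₂.comp (hΦ.of_le (by norm_num)) hmap).contDiffAt hRz).differentiableAt one_ne_zero
    have hPd : DifferentiableAt ℝ P z := (hP.contDiffAt hRz).differentiableAt one_ne_zero
    have htd := ((hasDerivAt_tan (hcosR z hz).ne').comp_hasFDerivAt z
      (hasFDerivAt_fst (𝕜 := ℝ) (p := z)))
    have hQd := (hX₂d.hasFDerivAt.sub (htd.mul hPd.hasFDerivAt)).fderiv
    have hQd' : fderiv ℝ Q z = _ := hQd
    have hd := hu.divergence_eq_zero hΩ (hmap hz)
    rw [hQd', h1.1]
    simp only [sub_apply, add_apply, smul_apply, smul_eq_mul, h2.2, h1.2, hPdef,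
      ContinuousLinearMap.coe_fst', Function.comp_apply, mul_zero, add_zero]
    linarith
  have hexp : ∀ z : ℝ × ℝ, 0 < cos z.1 → exp (grimShear z).2 = exp z.2 / cos z.1 :=
    fun z hz => by rw [grimShear, exp_sub, exp_log hz]
  have hPp : ∀ z ∈ Ioo s r ×ˢ Ioo a b, |P z| ≤ exp z.2 / cos z.1 := by
    intro z hz
    have hc := hcosR z hz
    simp only [hPdef, fluxDensity, hexp z hc]
    set A := pdx u (grimShear z)
    set B := pdt u (grimShear z)
    have hW : 0 < √(1 + A ^ 2 + B ^ 2) := sqrt_pos.2 (by positivity)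
    have hE : 0 < exp z.2 / cos z.1 := by positivity
    rw [abs_div, abs_mul, abs_of_pos hW, abs_of_pos hE, div_le_iff₀ hW]
    exact mul_le_mul_of_nonneg_left (abs_le_sqrt (by nlinarith [sq_nonneg B])) hE.le
  have hQq : ∀ z ∈ Ioo s r ×ˢ Ioo a b, |Q z| ≤ exp z.2 / cos z.1 ^ 2 := by
    intro z hz
    have hc := hcosR z hz
    simp only [hQdef, hPdef, fluxDensity, hexp z hc]
    set A := pdx u (grimShear z)
    set B := pdt u (grimShear z)
    have hW : 0 < √(1 + A ^ 2 + B ^ 2) := sqrt_pos.2 (by positivity)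
    have hE : 0 < exp z.2 / cos z.1 ^ 2 := by positivity
    have e : exp z.2 / cos z.1 * B / √(1 + A ^ 2 + B ^ 2)
        - tan z.1 * (exp z.2 / cos z.1 * A / √(1 + A ^ 2 + B ^ 2))
        = exp z.2 / cos z.1 ^ 2 * (1 * (-sin z.1 * A + cos z.1 * B))
          / √(1 + A ^ 2 + B ^ 2) := by
      rw [tan_eq_sin_div_cos]
      field_simp
      ring
    rw [e, abs_div, abs_mul, abs_of_pos hW, abs_of_pos hE, div_le_iff₀ hW]
    refine mul_le_mul_of_nonneg_left ?_ hE.le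
    refine (abs_unit_combination_le (by simp) (by rw [neg_sq, sin_sq_add_cos_sq])).trans ?_
    exact sqrt_le_sqrt (by linarith)
  have hpc : ContinuousOn (fun z : ℝ × ℝ => exp z.2 / cos z.1) (Icc s r ×ˢ Icc a b) :=
    ContinuousOn.div (by fun_prop) (by fun_prop) fun z hz => (hcos _ hz.1).ne'
  have hqc : ContinuousOn (fun z : ℝ × ℝ => exp z.2 / cos z.1 ^ 2) (Icc s r ×ˢ Icc a b) :=
    ContinuousOn.div (by fun_prop) (by fun_prop) fun z hz => pow_ne_zero 2 (hcos _ hz.1).ne'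
  obtain ⟨K, hKb⟩ := (isCompact_Icc.prod isCompact_Icc).exists_bound_of_continuousOn hpc
  have hKz : ∀ z ∈ Ioo s r ×ˢ Ioo a b, exp z.2 / cos z.1 ≤ K := fun z hz =>
    (le_abs_self _).trans (hKb z (prod_mono Ioo_subset_Icc_self Ioo_subset_Icc_self hz))
  have hK : 0 ≤ K := (norm_nonneg _).trans
    (hKb (s, a) ⟨left_mem_Icc.2 hsr.le, left_mem_Icc.2 hab.le⟩)
  have hcal : ∀ z ∈ Ioo s r ×ˢ Ioo a b, ∀ L : ℝ,
      L ≤ √(pdx u (grimShear z) ^ 2 + pdt u (grimShear z) ^ 2) →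
      exp z.2 / cos z.1 * L - K
        ≤ P z * fderiv ℝ (fun z => u (grimShear z)) z (1, 0)
          + Q z * fderiv ℝ (fun z => u (grimShear z)) z (0, 1) := by
    intro z hz L hL
    have hc := hcosR z hz
    have h1 := fderiv_comp_grimShear hc (hdiff two_ne_zero hu.1 z hz)
    rw [h1.1, h1.2]
    simp only [hQdef, hPdef, fluxDensity, hexp z hc]
    set A := pdx u (grimShear z)
    set B := pdt u (grimShear z)
    have hE : 0 < exp z.2 / cos z.1 := by positivity
    have h2 := mul_le_mul_of_nonneg_left (sub_one_le_div_sqrt hL) hE.le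
    have h3 := hKz z hz
    have e : exp z.2 / cos z.1 * A / √(1 + A ^ 2 + B ^ 2) * (A + tan z.1 * B)
        + (exp z.2 / cos z.1 * B / √(1 + A ^ 2 + B ^ 2)
          - tan z.1 * (exp z.2 / cos z.1 * A / √(1 + A ^ 2 + B ^ 2))) * B
        = exp z.2 / cos z.1 * ((A ^ 2 + B ^ 2) / √(1 + A ^ 2 + B ^ 2)) := by ring
    rw [e]
    linarith
  have htop : ∀ x ∈ Ioo s r,
      Tendsto (fun z => u (grimShear z)) (𝓝[Ioo s r ×ˢ Ioo a b] (x, b)) atTop := fun x hx =>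
    hcont (x, b) (Ioo_subset_Icc_self hx) _ (hA _ (Or.inr ⟨x, hx, rfl⟩))
  have hbot : ∀ x ∈ Ioo s r,
      Tendsto (fun z => u (grimShear z)) (𝓝[Ioo s r ×ˢ Ioo a b] (x, a)) atTop := fun x hx =>
    hcont (x, a) (Ioo_subset_Icc_self hx) _ (hA _ (Or.inl ⟨x, hx, rfl⟩))
  have hleft : ∀ y ∈ Ioo a b,
      Tendsto (fun z => u (grimShear z)) (𝓝[Ioo s r ×ˢ Ioo a b] (s, y)) atBot := fun y hy =>
    hcont (s, y) (left_mem_Icc.2 hsr.le) _ (hC _ (Or.inl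
      ⟨rfl, sub_lt_sub_right hy.1 _, sub_lt_sub_right hy.2 _⟩))
  have hright : ∀ y ∈ Ioo a b,
      Tendsto (fun z => u (grimShear z)) (𝓝[Ioo s r ×ˢ Ioo a b] (r, y)) atBot := fun y hy =>
    hcont (r, y) (right_mem_Icc.2 hsr.le) _ (hC _ (Or.inr
      ⟨rfl, sub_lt_sub_right hy.1 _, sub_lt_sub_right hy.2 _⟩))
  have hcosC : ContDiff ℝ 1 (fun z : ℝ × ℝ => cos z.1) := contDiff_cos.comp contDiff_fst
  have hexpC : ContDiff ℝ 1 (fun z : ℝ × ℝ => exp z.2) := contDiff_exp.comp contDiff_snd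
  have hle := rectangle_flux_le hsr hab hK
    (Z₁ := fun z => (2 * z.2 - a - b) / (b - a) * -(exp z.2 * tan z.1))
    (Z₂ := fun z => (2 * z.2 - a - b) / (b - a) * (exp z.2 / cos z.1 ^ 2)) hv hP hQ
    (fun z hz => ContDiffAt.mul (by fun_prop)
      (hexpC.contDiffAt.mul (htan z (hcos _ hz.1))).neg)
    (fun z hz => ContDiffAt.mul (by fun_prop)
      (hexpC.contDiffAt.div (hcosC.contDiffAt.pow 2) (pow_ne_zero 2 (hcos _ hz.1).ne')))
    hpc hqc hdiv hPp hQq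
    (fun z hz => by
      have hc := hcosR z hz
      have h1 := fderiv_comp_grimShear hc (hdiff two_ne_zero hu.1 z hz)
      have h2 := hcal z hz _ (le_of_abs_le (abs_unit_combination_le
        (A := pdx u (grimShear z)) (B := pdt u (grimShear z)) (abs_affine_le_one hz.2)
        (c := -sin z.1) (d := cos z.1) (by rw [neg_sq, sin_sq_add_cos_sq])))
      refine le_trans (le_of_eq ?_) h2
      rw [h1.1, h1.2, tan_eq_sin_div_cos]
      have hba : b - a ≠ 0 := by linarith
      field_simp
      linear_combination (-(pdt u (grimShear z)) * (2 * z.2 - a - b) * exp z.2)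
        * sin_sq_add_cos_sq z.1)
    htop hbot hleft hright
  have hge := rectangle_flux_le' hsr hab hK
    (Z₁ := fun z => (2 * z.1 - s - r) / (r - s) * (exp z.2 / cos z.1))
    (Z₂ := fun z => (2 * z.1 - s - r) / (r - s) * -(exp z.2 / cos z.1 * tan z.1)) hv hP hQ
    (fun z hz => ContDiffAt.mul (by fun_prop)
      (hexpC.contDiffAt.div hcosC.contDiffAt (hcos _ hz.1).ne'))
    (fun z hz => ContDiffAt.mul (by fun_prop)
      ((hexpC.contDiffAt.div hcosC.contDiffAt (hcos _ hz.1).ne').mul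
        (htan z (hcos _ hz.1))).neg)
    hpc hqc hdiv hPp hQq
    (fun z hz => by
      have hc := hcosR z hz
      have h1 := fderiv_comp_grimShear hc (hdiff two_ne_zero hu.1 z hz)
      have h2 := hcal z hz _ ((neg_le_abs _).trans (abs_unit_combination_le
        (A := pdx u (grimShear z)) (B := pdt u (grimShear z)) (abs_affine_le_one hz.1)
        (c := 1) (d := 0) (by norm_num)))
      refine le_trans (le_of_eq ?_) h2
      rw [h1.1, h1.2]
      ring)
    htop hbot hleft hright
  have ha1 : (2 * a - a - b) / (b - a) = -1 := by
    rw [div_eq_iff (by linarith)]; ring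
  have hb1 : (2 * b - a - b) / (b - a) = 1 := by
    rw [div_eq_iff (by linarith)]; ring
  have hs1 : (2 * s - s - r) / (r - s) = -1 := by
    rw [div_eq_iff (by linarith)]; ring
  have hr1 : (2 * r - s - r) / (r - s) = 1 := by
    rw [div_eq_iff (by linarith)]; ring
  have hsec : ∀ h : ℝ, ∫ x in s..r, exp h / cos x ^ 2 = exp h * (tan r - tan s) := fun h => by
    rw [← integral_inv_cos_sq_of_mem hs hsr hr, ← intervalIntegral.integral_const_mul]
    simp only [mul_one_div]
  have hvert : ∀ x : ℝ, ∫ y in a..b, exp y / cos x = (exp b - exp a) / cos x := fun x => by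
    rw [intervalIntegral.integral_div, integral_exp]
  simp only [ha1, hb1, neg_mul, one_mul, intervalIntegral.integral_neg, hsec, hvert] at hle
  simp only [hs1, hr1, neg_mul, one_mul, intervalIntegral.integral_neg, hsec, hvert] at hge
  refine le_antisymm ?_ ?_
  · linarith [mul_one_div (exp b - exp a) (cos r), mul_one_div (exp b - exp a) (cos s)]
  · linarith [mul_one_div (exp b - exp a) (cos r), mul_one_div (exp b - exp a) (cos s)]
end
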